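/- Let d ≥ 1, α ∈ (0,2) and 0 ≤ q < d + 2α. Then there exists a constant C = C(d,α,q) ≥ 1 such that for all v ∈ ℝ^d, C^{-1} (1+|v|)^{q−d−α} ≤ ∫_{ℝ^d} |x|^q p₁(x,v) dx ≤ C (1+|v|)^{q−d−α}. Equivalently, the conditional moment 𝔼(|X₁|^q | V₁ = v) = (∫_{ℝ^d} |x|^q p₁(x,v) dx)/(∫_{ℝ^d} p₁(x,v) dx) is comparable to (1+|v|)^q uniformly in v. -/

import Mathlib

open MeasureTheory Real RealInnerProductSpace

/-- The kinetic heat kernel of `Δ_v^{α/2} + v·∇_x`, via its Fourier integral. -/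
noncomputable def kinHeat (d : ℕ) (α t : ℝ) (x v : EuclideanSpace ℝ (Fin d)) : ℝ :=
  (2 * π) ^ (-(2 * (d : ℝ))) *
    ∫ w : EuclideanSpace ℝ (Fin d) × EuclideanSpace ℝ (Fin d),
      Real.cos (⟪x, w.1⟫ + ⟪v, w.2⟫) *
        Real.exp (-∫ s in (0 : ℝ)..t, ‖s • w.1 + w.2‖ ^ α)

open Filter Topology ENNReal
set_option maxSynthPendingDepth 3
set_option linter.unusedSectionVars false

section Smooth

variable {Ω W : Type*} [MeasurableSpace Ω] [NormedAddCommGroup W] [NormedSpace ℝ W]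

/-- Differentiation under the integral sign to all orders, with polynomial bounds. -/
theorem contDiff_integral_of_iteratedFDeriv_bound {m : Measure Ω} {F : Ω → W → ℝ}
    (hF : ∀ ω, ContDiff ℝ (⊤ : ℕ∞) (F ω))
    (hmeas : ∀ n w, AEStronglyMeasurable (fun ω => iteratedFDeriv ℝ n (F ω) w) m)
    (b : ℕ → Ω → ℝ) (hb : ∀ n, Integrable (b n) m) (hb0 : ∀ n ω, 0 ≤ b n ω) (k : ℕ)
    (hbound : ∀ n, ∀ᵐ ω ∂m, ∀ w, ‖iteratedFDeriv ℝ n (F ω) w‖ ≤ b n ω * (1 + ‖w‖) ^ k) :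
    ContDiff ℝ (⊤ : ℕ∞) (fun w => ∫ ω, F ω w ∂m) ∧
      ∀ n w, ‖iteratedFDeriv ℝ n (fun w => ∫ ω, F ω w ∂m) w‖ ≤
        (∫ ω, b n ω ∂m) * (1 + ‖w‖) ^ k := by
  have h_int : ∀ n w, Integrable (fun ω => iteratedFDeriv ℝ n (F ω) w) m := fun n w =>
    ((hb n).mul_const ((1 + ‖w‖) ^ k)).mono' (hmeas n w)
      ((hbound n).mono fun ω h => h w)
  have hder : ∀ n w, HasFDerivAt (fun y => ∫ ω, iteratedFDeriv ℝ n (F ω) y ∂m)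
      ((∫ ω, iteratedFDeriv ℝ (n + 1) (F ω) w ∂m).curryLeft) w := by
    intro n w
    have hfd : ∀ ω y, fderiv ℝ (iteratedFDeriv ℝ n (F ω)) y =
        continuousMultilinearCurryLeftEquiv ℝ (fun _ : Fin (n + 1) => W) ℝ
          (iteratedFDeriv ℝ (n + 1) (F ω) y) := by
      intro ω y
      rw [iteratedFDeriv_succ_eq_comp_left]
      simp
    have hcm : AEStronglyMeasurable (fun ω => fderiv ℝ (iteratedFDeriv ℝ n (F ω)) w) m := by
      simp_rw [hfd]
      exact (continuousMultilinearCurryLeftEquiv ℝ (fun _ : Fin (n + 1) => W)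
        ℝ).continuous.comp_aestronglyMeasurable (hmeas (n + 1) w)
    have hci : Integrable (fun ω => fderiv ℝ (iteratedFDeriv ℝ n (F ω)) w) m :=
      (h_int (n + 1) w).norm.mono' hcm (Eventually.of_forall fun ω => by
        rw [norm_fderiv_iteratedFDeriv])
    have e : (∫ ω, iteratedFDeriv ℝ (n + 1) (F ω) w ∂m).curryLeft =
        ∫ ω, fderiv ℝ (iteratedFDeriv ℝ n (F ω)) w ∂m := by
      ext w' u
      rw [ContinuousMultilinearMap.curryLeft_apply, ContinuousMultilinearMap.integral_apply
        (h_int (n + 1) w), ContinuousLinearMap.integral_apply hci,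
        ContinuousMultilinearMap.integral_apply (hci.apply_continuousLinearMap _)]
      simp [iteratedFDeriv_succ_apply_left]
    rw [e]
    refine hasFDerivAt_integral_of_dominated_of_fderiv_le
      (F' := fun y ω => fderiv ℝ (iteratedFDeriv ℝ n (F ω)) y)
      (bound := fun ω => b (n + 1) ω * (2 + ‖w‖) ^ k)
      (Metric.ball_mem_nhds w one_pos) (Eventually.of_forall (hmeas n)) (h_int n w) hcm ?_
      ((hb (n + 1)).mul_const _) ?_
    · filter_upwards [hbound (n + 1)] with ω hω y hy
      rw [norm_fderiv_iteratedFDeriv]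
      refine (hω y).trans (mul_le_mul_of_nonneg_left ?_ (hb0 _ _))
      have : ‖y‖ ≤ ‖w‖ + 1 := by
        have := norm_le_norm_add_norm_sub' y w
        rw [mem_ball_iff_norm] at hy
        linarith
      exact pow_le_pow_left₀ (by positivity) (by linarith) _
    · refine Eventually.of_forall fun ω y _ => ?_
      exact ((hF ω).differentiable_iteratedFDeriv
        (by exact_mod_cast WithTop.coe_lt_top n) y).hasFDerivAt
  have hT : HasFTaylorSeriesUpTo (⊤ : ℕ∞) (fun w => ∫ ω, F ω w ∂m)
      (fun w n => ∫ ω, iteratedFDeriv ℝ n (F ω) w ∂m) := by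
    refine ⟨fun w => ?_, fun n _ w => hder n w, fun n _ => ?_⟩
    · have := ((continuousMultilinearCurryFin0 ℝ W ℝ).toContinuousLinearEquiv.integral_comp_comm
        (μ := m) (fun ω => iteratedFDeriv ℝ 0 (F ω) w)).symm
      exact this
    · exact continuous_iff_continuousAt.2 fun w => (hder n w).continuousAt
  refine ⟨hT.contDiff, fun n w => ?_⟩
  rw [← hT.eq_iteratedFDeriv (by exact_mod_cast le_top), ← integral_mul_const]
  exact norm_integral_le_of_norm_le ((hb n).mul_const _) ((hbound n).mono fun ω h => h w)

end Smooth

section Smooth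

variable {Ω W : Type*} [MeasurableSpace Ω] [NormedAddCommGroup W] [NormedSpace ℝ W]

theorem norm_iteratedFDeriv_one_sub_cos_le (L : W →L[ℝ] ℝ) (n : ℕ) (w : W) :
    ‖iteratedFDeriv ℝ n (fun w => 1 - Real.cos (L w)) w‖ ≤
      ‖L‖ ^ 2 * (1 + ‖L‖) ^ n * (1 + ‖w‖) ^ 2 := by
  have hL : |L w| ≤ ‖L‖ * ‖w‖ := L.le_opNorm w
  have hL0 := norm_nonneg L
  have hw0 := norm_nonneg w
  have hcd : ContDiff ℝ (⊤ : ℕ∞) (fun t : ℝ => 1 - Real.cos t) := by fun_prop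
  have key : ∀ n, ‖iteratedFDeriv ℝ n (fun w => 1 - Real.cos (L w)) w‖ ≤
      |iteratedDeriv n (fun t : ℝ => 1 - Real.cos t) (L w)| * ‖L‖ ^ n := by
    intro n
    have := L.iteratedFDeriv_comp_right hcd w (i := n) (by exact_mod_cast le_top)
    rw [Function.comp_def] at this
    rw [this]
    refine (ContinuousMultilinearMap.norm_compContinuousLinearMap_le _ _).trans ?_
    rw [norm_iteratedFDeriv_eq_norm_iteratedDeriv]
    simp
  have hcos : ∀ n, 1 ≤ n → ∀ t, iteratedDeriv n (fun t : ℝ => 1 - Real.cos t) t =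
      - iteratedDeriv n Real.cos t := by
    intro n hn t
    rw [iteratedDeriv_const_sub hn]
    simp
  have h1 : (1 : ℝ) ≤ (1 + ‖w‖) ^ 2 := one_le_pow₀ (by linarith)
  match n with
  | 0 =>
    refine (key 0).trans ?_
    have h := Real.one_sub_sq_div_two_le_cos (x := L w)
    have h' := Real.cos_le_one (L w)
    rw [iteratedDeriv_zero, abs_of_nonneg (by linarith)]
    have h3 : (L w) ^ 2 ≤ (‖L‖ * ‖w‖) ^ 2 := sq_le_sq' (by linarith [abs_le.1 hL]) (abs_le.1 hL).2
    rw [mul_pow] at h3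
    have : ‖L‖ ^ 2 * ‖w‖ ^ 2 ≤ ‖L‖ ^ 2 * (1 + ‖w‖) ^ 2 := by gcongr; linarith
    have := sq_nonneg (L w)
    simp only [pow_zero, mul_one]
    linarith
  | 1 =>
    refine (key 1).trans ?_
    rw [hcos 1 le_rfl, iteratedDeriv_one, Real.deriv_cos, neg_neg]
    have : |Real.sin (L w)| ≤ ‖L‖ * ‖w‖ := Real.abs_sin_le_abs.trans hL
    have h4 : ‖w‖ ≤ (1 + ‖w‖) ^ 2 := by nlinarith
    calc |Real.sin (L w)| * ‖L‖ ^ 1 ≤ (‖L‖ * ‖w‖) * ‖L‖ ^ 1 := by gcongr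
      _ = ‖L‖ ^ 2 * 1 * ‖w‖ := by ring
      _ ≤ ‖L‖ ^ 2 * (1 + ‖L‖) ^ 1 * (1 + ‖w‖) ^ 2 := by gcongr; linarith
  | n + 2 =>
    refine (key (n + 2)).trans ?_
    rw [hcos _ (by lia), abs_neg]
    calc _ ≤ 1 * ‖L‖ ^ (n + 2) := by gcongr; exact Real.abs_iteratedDeriv_cos_le_one _ _
      _ = ‖L‖ ^ 2 * ‖L‖ ^ n * 1 := by ring
      _ ≤ ‖L‖ ^ 2 * (1 + ‖L‖) ^ (n + 2) * (1 + ‖w‖) ^ 2 := by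
        gcongr
        calc ‖L‖ ^ n ≤ (1 + ‖L‖) ^ n := by gcongr; linarith
          _ ≤ (1 + ‖L‖) ^ (n + 2) := by gcongr <;> linarith

theorem contDiff_integral_one_sub_cos {m : Measure Ω} {L : Ω → W →L[ℝ] ℝ}
    (hL : AEStronglyMeasurable L m) (hL2 : Integrable (fun ω => ‖L ω‖ ^ 2) m)
    (hLb : ∀ᵐ ω ∂m, ‖L ω‖ ≤ 2) :
    ContDiff ℝ (⊤ : ℕ∞) (fun w => ∫ ω, (1 - Real.cos (L ω w)) ∂m) ∧
      ∃ K : ℕ → ℝ, ∀ n w, ‖iteratedFDeriv ℝ n (fun w => ∫ ω, (1 - Real.cos (L ω w)) ∂m) w‖ ≤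
        K n * (1 + ‖w‖) ^ 2 := by
  have hcd : ContDiff ℝ (⊤ : ℕ∞) (fun t : ℝ => 1 - Real.cos t) := by fun_prop
  have := contDiff_integral_of_iteratedFDeriv_bound (m := m)
    (F := fun ω w => 1 - Real.cos (L ω w)) (fun ω => by fun_prop) ?_
    (fun n ω => ‖L ω‖ ^ 2 * 3 ^ n) (fun n => hL2.mul_const _) (fun n ω => by positivity) 2 ?_
  · exact ⟨this.1, _, this.2⟩
  · intro n w
    have e : (fun ω => iteratedFDeriv ℝ n (fun w => 1 - Real.cos (L ω w)) w) = fun ω =>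
        (ContinuousMultilinearMap.compContinuousLinearMapContinuousMultilinear ℝ
          (fun _ : Fin n => W) (fun _ : Fin n => ℝ) ℝ (fun _ => L ω))
          (iteratedFDeriv ℝ n (fun t : ℝ => 1 - Real.cos t) (L ω w)) := by
      ext1 ω
      exact (L ω).iteratedFDeriv_comp_right hcd w (i := n) (by exact_mod_cast le_top)
    rw [e]
    have hc : Continuous (fun ℓ : W →L[ℝ] ℝ =>
        (ContinuousMultilinearMap.compContinuousLinearMapContinuousMultilinear ℝ
          (fun _ : Fin n => W) (fun _ : Fin n => ℝ) ℝ (fun _ => ℓ))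
          (iteratedFDeriv ℝ n (fun t : ℝ => 1 - Real.cos t) (ℓ w))) := by
      refine Continuous.clm_apply ?_ ?_
      · exact (ContinuousMultilinearMap.cont _).comp (continuous_pi fun _ => continuous_id)
      · exact (hcd.continuous_iteratedFDeriv (m := n) (by exact_mod_cast le_top)).comp
          (continuous_id.clm_apply continuous_const)
    exact hc.comp_aestronglyMeasurable hL
  · intro n
    filter_upwards [hLb] with ω hω w
    refine (norm_iteratedFDeriv_one_sub_cos_le (L ω) n w).trans ?_
    gcongr
    linarith

theorem norm_iteratedFDeriv_exp_neg_le {ψ : W → ℝ} (hψ : ContDiff ℝ (⊤ : ℕ∞) ψ) {K : ℕ → ℝ}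
    (hK : ∀ n w, ‖iteratedFDeriv ℝ n ψ w‖ ≤ K n * (1 + ‖w‖) ^ 2) (n : ℕ) :
    ∃ D, 0 ≤ D ∧ ∀ w, ‖iteratedFDeriv ℝ n (fun w => Real.exp (-ψ w)) w‖ ≤
      D * (1 + ‖w‖) ^ (2 * n) * Real.exp (-ψ w) := by
  set S : ℝ := 1 + ∑ i ∈ Finset.range (n + 1), |K i| with hS
  have hS1 : 1 ≤ S := by
    have : 0 ≤ ∑ i ∈ Finset.range (n + 1), |K i| := Finset.sum_nonneg fun i _ => abs_nonneg _
    linarith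
  refine ⟨n.factorial * S ^ n, by positivity, fun w => ?_⟩
  have := norm_iteratedFDeriv_comp_le (g := fun t : ℝ => Real.exp (-t)) (f := ψ) (n := n)
    (N := (⊤ : ℕ∞)) (by fun_prop) hψ (by exact_mod_cast le_top) w (C := Real.exp (-ψ w))
    (D := S * (1 + ‖w‖) ^ 2) ?_ ?_
  · refine this.trans (le_of_eq ?_)
    rw [mul_pow, ← pow_mul]
    ring
  · intro i _
    rw [norm_iteratedFDeriv_eq_norm_iteratedDeriv, iteratedDeriv_comp_neg i Real.exp,
      iteratedDeriv_eq_iterate, Real.iter_deriv_exp]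
    simp
  · intro i h1 hi
    have hKi : |K i| ≤ S := by
      have := Finset.single_le_sum (f := fun i => |K i|) (fun i _ => abs_nonneg _)
        (Finset.mem_range.2 (Nat.lt_succ_of_le hi))
      linarith
    calc _ ≤ K i * (1 + ‖w‖) ^ 2 := hK i w
      _ ≤ S * (1 + ‖w‖) ^ 2 := by gcongr; exact (le_abs_self _).trans hKi
      _ ≤ _ := le_self_pow₀ (by
        have : (1 : ℝ) ≤ (1 + ‖w‖) ^ 2 := one_le_pow₀ (by linarith [norm_nonneg w])
        nlinarith) (by lia)

end Smooth

section Transform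

variable {E : Type*} [NormedAddCommGroup E] [InnerProductSpace ℝ E] [FiniteDimensional ℝ E]
  [MeasurableSpace E] [BorelSpace E]

/-- The duality pairing on the phase space `E × E`. -/
noncomputable def phasePairing (E : Type*) [NormedAddCommGroup E] [InnerProductSpace ℝ E] :
    E × E →L[ℝ] E × E →L[ℝ] ℝ :=
  (innerSL ℝ).bilinearComp (ContinuousLinearMap.fst ℝ E E) (ContinuousLinearMap.fst ℝ E E) +
    (innerSL ℝ).bilinearComp (ContinuousLinearMap.snd ℝ E E) (ContinuousLinearMap.snd ℝ E E)

theorem phasePairing_apply (y w : E × E) :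
    phasePairing E y w = ⟪y.1, w.1⟫ + ⟪y.2, w.2⟫ := by
  simp [phasePairing]

/-- The (unnormalised) cosine transform on the phase space. -/
noncomputable def cosTransform (φ : E × E → ℝ) (y : E × E) : ℝ :=
  ∫ w : E × E, Real.cos (⟪y.1, w.1⟫ + ⟪y.2, w.2⟫) * φ w

theorem integrable_cos_mul {φ : E × E → ℝ} (hφ : Integrable φ) (y : E × E) :
    Integrable (fun w : E × E => Real.cos (⟪y.1, w.1⟫ + ⟪y.2, w.2⟫) * φ w) := by
  refine hφ.bdd_mul (c := 1) (Continuous.aestronglyMeasurable (by fun_prop)) ?_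
  exact Eventually.of_forall fun w => Real.abs_cos_le_one _

theorem continuous_cosTransform {φ : E × E → ℝ} (hφ : Integrable φ) :
    Continuous (cosTransform φ) := by
  refine continuous_of_dominated (F := fun (y w : E × E) =>
    Real.cos (⟪y.1, w.1⟫ + ⟪y.2, w.2⟫) * φ w) (fun y => (integrable_cos_mul hφ y).1)
    (bound := fun w => ‖φ w‖) (fun y => Eventually.of_forall fun w => ?_) hφ.norm
    (Eventually.of_forall fun w => by fun_prop)
  rw [norm_mul]
  exact mul_le_of_le_one_left (norm_nonneg _) (Real.abs_cos_le_one _)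

theorem abs_cosTransform_le {φ : E × E → ℝ} (hφ : Integrable φ) (y : E × E) :
    |cosTransform φ y| ≤ ∫ w, |φ w| := by
  refine (norm_integral_le_integral_norm _).trans (integral_mono (integrable_cos_mul hφ y).norm
    hφ.norm fun w => ?_)
  simp only [norm_mul]
  exact mul_le_of_le_one_left (norm_nonneg _) (Real.abs_cos_le_one _)

instance isAddHaarMeasure_volume_prod : (volume : Measure (E × E)).IsAddHaarMeasure :=
  inferInstanceAs ((volume : Measure E).prod (volume : Measure E)).IsAddHaarMeasure

/-- Integrating by parts: a smooth symbol with integrable derivatives has a rapidly decreasing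
cosine transform. -/
theorem exists_abs_pairing_pow_mul_cosTransform_le {φ : E × E → ℝ} (hφ : ContDiff ℝ (⊤ : ℕ∞) φ)
    (h_int : ∀ n, Integrable (fun w => ‖iteratedFDeriv ℝ n φ w‖)) (n : ℕ) :
    ∃ C, 0 ≤ C ∧ ∀ w y : E × E,
      |⟪y.1, w.1⟫ + ⟪y.2, w.2⟫| ^ n * |cosTransform φ y| ≤ ‖w‖ ^ n * C := by
  set L : E × E →L[ℝ] E × E →L[ℝ] ℝ := (2 * π)⁻¹ • phasePairing E with hL
  have hLa : ∀ w y, L w y = (2 * π)⁻¹ * (⟪w.1, y.1⟫ + ⟪w.2, y.2⟫) := fun w y => by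
    simp [hL, phasePairing_apply]
  set f : E × E → ℂ := fun w => (φ w : ℂ) with hf
  have hfn : ∀ n w, ‖iteratedFDeriv ℝ n f w‖ = ‖iteratedFDeriv ℝ n φ w‖ := fun n w =>
    Complex.ofRealLI.norm_iteratedFDeriv_comp_left (hφ.contDiffAt)
      (by exact_mod_cast le_top)
  have hfc : ContDiff ℝ (⊤ : ℕ∞) f := Complex.ofRealCLM.contDiff.comp hφ
  have key := fun w y => VectorFourier.pow_mul_norm_iteratedFDeriv_fourierIntegral_le
    (μ := (volume : Measure (E × E))) L (K := 0) (N := ⊤) hfc (by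
      intro k n hk _
      have : k = 0 := by simpa using hk
      subst this
      simpa [hfn] using h_int n) (k := 0) (n := n) le_rfl le_top w y
  refine ⟨(2 * π) ^ n * (2 ^ n * ∑ p ∈ Finset.range 1 ×ˢ Finset.range (n + 1),
    ∫ v, ‖v‖ ^ p.1 * ‖iteratedFDeriv ℝ p.2 f v‖), ?_, fun w y => ?_⟩
  · refine mul_nonneg (by positivity) (mul_nonneg (by positivity) (Finset.sum_nonneg fun p _ =>
      integral_nonneg fun v => by positivity))
  have h := key w y
  rw [norm_iteratedFDeriv_zero] at h
  have hre : |cosTransform φ y| ≤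
      ‖VectorFourier.fourierIntegral Real.fourierChar volume L.toLinearMap₁₂ f y‖ := by
    have : cosTransform φ y =
        (VectorFourier.fourierIntegral Real.fourierChar volume L.toLinearMap₁₂ f y).re := by
      rw [VectorFourier.fourierIntegral, cosTransform]
      have hfi : Integrable (fun w : E × E => Real.fourierChar (-(L w y)) • f w) := by
        have : Integrable φ := (h_int 0).mono' hφ.continuous.aestronglyMeasurable
          (Eventually.of_forall fun w => by rw [norm_iteratedFDeriv_zero])
        exact (VectorFourier.fourierIntegral_convergent_iff (e := Real.fourierChar) (μ := volume)
          (L := L.toLinearMap₁₂) Real.continuous_fourierChar L.continuous₂ y).2 this.ofReal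
      refine Eq.trans ?_ (integral_re hfi)
      refine integral_congr_ae (Eventually.of_forall fun w => ?_)
      have e : 2 * π * L w y = ⟪y.1, w.1⟫ + ⟪y.2, w.2⟫ := by
        rw [hLa, real_inner_comm y.1, real_inner_comm y.2]
        field_simp
      simp only [Circle.smul_def, Real.fourierChar_apply, hf, smul_eq_mul, mul_neg, e]
      rw [mul_comm (Complex.exp _)]
      simp only [RCLike.re_eq_complex_re, Complex.re_ofReal_mul]
      rw [Complex.exp_ofReal_mul_I_re, Real.cos_neg, mul_comm]
    rw [this]
    exact Complex.abs_re_le_norm _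
  have hpi : 0 < 2 * π := by positivity
  have e : |⟪y.1, w.1⟫ + ⟪y.2, w.2⟫| = (2 * π) * |L w y| := by
    rw [hLa, abs_mul, abs_of_pos (inv_pos.2 hpi), real_inner_comm y.1, real_inner_comm y.2]
    field_simp
  rw [e, mul_pow]
  calc _ ≤ (2 * π) ^ n * (|L w y| ^ n *
        ‖VectorFourier.fourierIntegral Real.fourierChar volume L.toLinearMap₁₂ f y‖) := by
        rw [mul_assoc]; gcongr
    _ ≤ (2 * π) ^ n * _ := mul_le_mul_of_nonneg_left h (by positivity)
    _ = _ := by simp only [zero_add, pow_zero, mul_one, Nat.cast_zero, mul_zero]; ring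

/-- A smooth symbol with integrable derivatives has a rapidly decreasing cosine transform. -/
theorem exists_pow_mul_cosTransform_le {φ : E × E → ℝ} (hφ : ContDiff ℝ (⊤ : ℕ∞) φ)
    (h_int : ∀ n, Integrable (fun w => ‖iteratedFDeriv ℝ n φ w‖)) (N : ℕ) :
    ∃ C, 0 ≤ C ∧ ∀ x v : E,
      (1 + ‖x‖) ^ N * (1 + ‖v‖) ^ N * |cosTransform φ (x, v)| ≤ C := by
  obtain ⟨A, hA0, hA⟩ := exists_abs_pairing_pow_mul_cosTransform_le hφ h_int 0
  obtain ⟨B, hB0, hB⟩ := exists_abs_pairing_pow_mul_cosTransform_le hφ h_int (2 * N)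
  have hA' : ∀ y, |cosTransform φ y| ≤ A := fun y => by simpa using hA 0 y
  have cancel : ∀ (a t : ℝ), 0 ≤ a → 0 ≤ t → t ≤ A →
      (a ^ 2) ^ (2 * N) * t ≤ a ^ (2 * N) * B → a ^ (2 * N) * t ≤ A + B := by
    intro a t ha ht htA h
    rcases ha.eq_or_lt with rfl | ha
    · rcases Nat.eq_zero_or_pos N with rfl | hN
      · simp; linarith
      · rw [zero_pow (by lia)]; linarith
    · rw [← pow_mul, mul_comm 2 (2 * N), pow_mul, sq, mul_assoc] at h
      have := le_of_mul_le_mul_left h (by positivity)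
      linarith
  have hx : ∀ x v : E, ‖x‖ ^ (2 * N) * |cosTransform φ (x, v)| ≤ A + B := by
    intro x v
    refine cancel _ _ (norm_nonneg x) (abs_nonneg _) (hA' _) ?_
    have := hB (x, 0) (x, v)
    simpa [real_inner_self_eq_norm_sq, Prod.norm_def] using this
  have hv : ∀ x v : E, ‖v‖ ^ (2 * N) * |cosTransform φ (x, v)| ≤ A + B := by
    intro x v
    refine cancel _ _ (norm_nonneg v) (abs_nonneg _) (hA' _) ?_
    have := hB (0, v) (x, v)
    simpa [real_inner_self_eq_norm_sq, Prod.norm_def] using this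
  refine ⟨2 ^ (2 * N) * (4 * (A + B)), by positivity, fun x v => ?_⟩
  have hp : ∀ a : ℝ, 0 ≤ a → (1 + a) ^ (2 * N) ≤ 2 ^ (2 * N) * (1 + a ^ (2 * N)) := by
    intro a ha
    rcases le_total a 1 with h | h
    · calc (1 + a) ^ (2 * N) ≤ 2 ^ (2 * N) := by gcongr; linarith
        _ ≤ _ := le_mul_of_one_le_right (by positivity) (by linarith [pow_nonneg ha (2 * N)])
    · calc (1 + a) ^ (2 * N) ≤ (2 * a) ^ (2 * N) := by gcongr; linarith
        _ = 2 ^ (2 * N) * a ^ (2 * N) := mul_pow _ _ _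
        _ ≤ _ := by gcongr; linarith
  have h2 : (1 + ‖x‖) ^ N * (1 + ‖v‖) ^ N ≤ (1 + ‖x‖) ^ (2 * N) + (1 + ‖v‖) ^ (2 * N) := by
    have := sq_nonneg ((1 + ‖x‖) ^ N - (1 + ‖v‖) ^ N)
    have h1 : 0 ≤ (1 + ‖x‖) ^ N * (1 + ‖v‖) ^ N := by positivity
    rw [pow_mul' _ 2 N, pow_mul' _ 2 N]
    nlinarith
  calc _ ≤ ((1 + ‖x‖) ^ (2 * N) + (1 + ‖v‖) ^ (2 * N)) * |cosTransform φ (x, v)| := by gcongr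
    _ ≤ (2 ^ (2 * N) * (1 + ‖x‖ ^ (2 * N)) + 2 ^ (2 * N) * (1 + ‖v‖ ^ (2 * N))) *
        |cosTransform φ (x, v)| := by
      gcongr
      · exact hp _ (norm_nonneg _)
      · exact hp _ (norm_nonneg _)
    _ = 2 ^ (2 * N) * (2 * |cosTransform φ (x, v)| + ‖x‖ ^ (2 * N) * |cosTransform φ (x, v)| +
        ‖v‖ ^ (2 * N) * |cosTransform φ (x, v)|) := by ring
    _ ≤ 2 ^ (2 * N) * (4 * (A + B)) := by
      gcongr
      linarith [hx x v, hv x v, hA' (x, v)]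

end Transform

section Convolution

variable {E : Type*} [NormedAddCommGroup E] [InnerProductSpace ℝ E] [FiniteDimensional ℝ E]
  [MeasurableSpace E] [BorelSpace E]

/-- The cosine part of the characteristic function of a measure on the phase space. -/
noncomputable def cosChar (ν : Measure (E × E)) (w : E × E) : ℝ :=
  ∫ y : E × E, Real.cos (⟪y.1, w.1⟫ + ⟪y.2, w.2⟫) ∂ν

theorem abs_cosChar_le (ν : Measure (E × E)) [IsFiniteMeasure ν] (w : E × E) :
    |cosChar ν w| ≤ ν.real Set.univ := by
  have := norm_integral_le_of_norm_le_const (μ := ν) (C := 1)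
    (f := fun y : E × E => Real.cos (⟪y.1, w.1⟫ + ⟪y.2, w.2⟫))
    (Eventually.of_forall fun y => Real.abs_cos_le_one _)
  simpa [cosChar] using this

theorem continuous_cosChar (ν : Measure (E × E)) [IsFiniteMeasure ν] :
    Continuous (cosChar ν) := by
  refine continuous_of_dominated (F := fun (w y : E × E) =>
    Real.cos (⟪y.1, w.1⟫ + ⟪y.2, w.2⟫)) (bound := fun _ => 1)
    (fun w => Continuous.aestronglyMeasurable (by fun_prop))
    (fun w => Eventually.of_forall fun y => Real.abs_cos_le_one _) (integrable_const _)
    (Eventually.of_forall fun y => by fun_prop)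

theorem integrable_mul_cosChar {φ : E × E → ℝ} (hφ : Integrable φ) (ν : Measure (E × E))
    [IsFiniteMeasure ν] : Integrable (fun w => φ w * cosChar ν w) :=
  hφ.mul_bdd (c := ν.real Set.univ) (continuous_cosChar ν).aestronglyMeasurable
    (Eventually.of_forall fun w => abs_cosChar_le ν w)

theorem integrable_mul_cosChar_pow {φ : E × E → ℝ} (hφ : Integrable φ) (ν : Measure (E × E))
    [IsFiniteMeasure ν] (n : ℕ) : Integrable (fun w => φ w * cosChar ν w ^ n) := by
  induction n with
  | zero => simpa using hφ
  | succ n ih => simpa [pow_succ, mul_assoc] using integrable_mul_cosChar ih ν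

theorem integral_sin_eq_zero (ν : Measure (E × E)) [ν.IsNegInvariant] (w : E × E) :
    ∫ y : E × E, Real.sin (⟪y.1, w.1⟫ + ⟪y.2, w.2⟫) ∂ν = 0 := by
  have := integral_neg_eq_self (fun y : E × E => Real.sin (⟪y.1, w.1⟫ + ⟪y.2, w.2⟫)) ν
  have h2 : ∀ y : E × E, Real.sin (⟪(-y).1, w.1⟫ + ⟪(-y).2, w.2⟫) =
      -Real.sin (⟪y.1, w.1⟫ + ⟪y.2, w.2⟫) := fun y => by
    rw [← Real.sin_neg]; simp [inner_neg_left]; ring_nf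
  simp only [h2, integral_neg] at this
  linarith

/-- Multiplying the symbol by a characteristic function convolves the transform. -/
theorem cosTransform_mul_cosChar {φ : E × E → ℝ} (hφ : Integrable φ) (ν : Measure (E × E))
    [IsFiniteMeasure ν] [ν.IsNegInvariant] (y : E × E) :
    cosTransform (fun w => φ w * cosChar ν w) y = ∫ z, cosTransform φ (y - z) ∂ν := by
  have hi : Integrable (fun p : (E × E) × (E × E) =>
      Real.cos (⟪(y - p.1).1, p.2.1⟫ + ⟪(y - p.1).2, p.2.2⟫) * φ p.2) (ν.prod volume) := by
    refine (hφ.comp_snd ν).bdd_mul (c := 1) (Continuous.aestronglyMeasurable (by fun_prop)) ?_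
    exact Eventually.of_forall fun w => Real.abs_cos_le_one _
  unfold cosTransform
  rw [integral_integral_swap hi]
  refine integral_congr_ae (Eventually.of_forall fun w => ?_)
  have h1 : ∀ z : E × E, Real.cos (⟪(y - z).1, w.1⟫ + ⟪(y - z).2, w.2⟫) * φ w =
      Real.cos (⟪y.1, w.1⟫ + ⟪y.2, w.2⟫) * φ w * Real.cos (⟪z.1, w.1⟫ + ⟪z.2, w.2⟫) +
      Real.sin (⟪y.1, w.1⟫ + ⟪y.2, w.2⟫) * φ w * Real.sin (⟪z.1, w.1⟫ + ⟪z.2, w.2⟫) := by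
    intro z
    have : ⟪(y - z).1, w.1⟫ + ⟪(y - z).2, w.2⟫ =
        (⟪y.1, w.1⟫ + ⟪y.2, w.2⟫) - (⟪z.1, w.1⟫ + ⟪z.2, w.2⟫) := by
      simp [inner_sub_left]; ring
    rw [this, Real.cos_sub]; ring
  simp only [h1]
  rw [integral_add, integral_const_mul, integral_const_mul, integral_sin_eq_zero, cosChar]
  · ring
  · refine Integrable.const_mul (Integrable.of_bound (C := 1)
      (Continuous.aestronglyMeasurable (by fun_prop))
      (Eventually.of_forall fun z => Real.abs_cos_le_one _)) _
  · refine Integrable.const_mul (Integrable.of_bound (C := 1)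
      (Continuous.aestronglyMeasurable (by fun_prop))
      (Eventually.of_forall fun z => Real.abs_sin_le_one _)) _

theorem cosTransform_mul_cosChar_pow_succ {φ : E × E → ℝ} (hφ : Integrable φ)
    (ν : Measure (E × E)) [IsFiniteMeasure ν] [ν.IsNegInvariant] (n : ℕ) (y : E × E) :
    cosTransform (fun w => φ w * cosChar ν w ^ (n + 1)) y =
      ∫ z, cosTransform (fun w => φ w * cosChar ν w ^ n) (y - z) ∂ν := by
  rw [← cosTransform_mul_cosChar (integrable_mul_cosChar_pow hφ ν n)]
  simp only [pow_succ, mul_assoc]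

theorem cosTransform_mul_cosChar_pow_nonneg {φ : E × E → ℝ} (hφ : Integrable φ)
    (h0 : ∀ y, 0 ≤ cosTransform φ y) (ν : Measure (E × E)) [IsFiniteMeasure ν]
    [ν.IsNegInvariant] (n : ℕ) (y : E × E) :
    0 ≤ cosTransform (fun w => φ w * cosChar ν w ^ n) y := by
  induction n generalizing y with
  | zero => simpa using h0 y
  | succ n ih =>
    rw [cosTransform_mul_cosChar_pow_succ hφ]
    exact integral_nonneg fun z => ih _

theorem ofReal_cosTransform_mul_cosChar_pow_succ {φ : E × E → ℝ} (hφ : Integrable φ)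
    (h0 : ∀ y, 0 ≤ cosTransform φ y) (ν : Measure (E × E)) [IsFiniteMeasure ν]
    [ν.IsNegInvariant] (n : ℕ) (y : E × E) :
    ENNReal.ofReal (cosTransform (fun w => φ w * cosChar ν w ^ (n + 1)) y) =
      ∫⁻ z, ENNReal.ofReal (cosTransform (fun w => φ w * cosChar ν w ^ n) (y - z)) ∂ν := by
  have hI := integrable_mul_cosChar_pow hφ ν n
  rw [cosTransform_mul_cosChar_pow_succ hφ, ofReal_integral_eq_lintegral_ofReal]
  · exact Integrable.of_bound (C := ∫ w, |φ w * cosChar ν w ^ n|)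
      ((continuous_cosTransform hI).comp (by fun_prop : Continuous fun z : E × E => y - z)
        |>.aestronglyMeasurable) (Eventually.of_forall fun z => abs_cosTransform_le hI _)
  · exact Eventually.of_forall fun z => cosTransform_mul_cosChar_pow_nonneg hφ h0 ν n _

/-- The compound Poisson expansion. -/
theorem hasSum_cosTransform_mul_exp_cosChar {φ : E × E → ℝ} (hφ : Integrable φ)
    (ν : Measure (E × E)) [IsFiniteMeasure ν] (y : E × E) :
    HasSum (fun n : ℕ => (n.factorial : ℝ)⁻¹ * cosTransform (fun w => φ w * cosChar ν w ^ n) y)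
      (cosTransform (fun w => φ w * Real.exp (cosChar ν w)) y) := by
  set F : ℕ → E × E → ℝ := fun n w =>
    (n.factorial : ℝ)⁻¹ * (Real.cos (⟪y.1, w.1⟫ + ⟪y.2, w.2⟫) * (φ w * cosChar ν w ^ n)) with hF
  have hFi : ∀ n, Integrable (F n) := fun n =>
    (integrable_cos_mul (integrable_mul_cosChar_pow hφ ν n) y).const_mul _
  have hbd : ∀ n, ∫ w, ‖F n w‖ ≤ (∫ w, |φ w|) * ((ν.real Set.univ) ^ n / n.factorial) := by
    intro n
    rw [← integral_mul_const]
    refine integral_mono (hFi n).norm (hφ.norm.mul_const _) fun w => ?_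
    simp only [hF, norm_mul, norm_inv, norm_pow, Real.norm_eq_abs, Nat.abs_cast]
    have h1 := Real.abs_cos_le_one (⟪y.1, w.1⟫ + ⟪y.2, w.2⟫)
    have h2 := abs_cosChar_le ν w
    calc _ ≤ (n.factorial : ℝ)⁻¹ * (1 * (|φ w| * (ν.real Set.univ) ^ n)) := by gcongr
      _ = _ := by ring
  have hsum : Summable fun n => ∫ w, ‖F n w‖ :=
    Summable.of_nonneg_of_le (fun n => integral_nonneg fun w => norm_nonneg _) hbd
      ((Real.summable_pow_div_factorial _).mul_left _)
  have := hasSum_integral_of_summable_integral_norm hFi hsum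
  have e1 : ∀ n, ∫ w, F n w =
      (n.factorial : ℝ)⁻¹ * cosTransform (fun w => φ w * cosChar ν w ^ n) y := fun n => by
    simp only [hF, integral_const_mul, cosTransform]
  have e2 : ∀ w, ∑' n, F n w =
      Real.cos (⟪y.1, w.1⟫ + ⟪y.2, w.2⟫) * (φ w * Real.exp (cosChar ν w)) := fun w => by
    rw [Real.exp_eq_exp_ℝ, NormedSpace.exp_eq_tsum_div, ← tsum_mul_left, ← tsum_mul_left]
    refine tsum_congr fun n => ?_
    simp only [hF]
    ring
  simp only [e1, e2] at this
  exact this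

theorem cosTransform_mul_exp_cosChar_nonneg {φ : E × E → ℝ} (hφ : Integrable φ)
    (h0 : ∀ y, 0 ≤ cosTransform φ y) (ν : Measure (E × E)) [IsFiniteMeasure ν]
    [ν.IsNegInvariant] (y : E × E) :
    0 ≤ cosTransform (fun w => φ w * Real.exp (cosChar ν w)) y := by
  rw [← (hasSum_cosTransform_mul_exp_cosChar hφ ν y).tsum_eq]
  exact tsum_nonneg fun n => mul_nonneg (by positivity)
    (cosTransform_mul_cosChar_pow_nonneg hφ h0 ν n y)

end Convolution

section Stable

variable {E : Type*} [NormedAddCommGroup E] [InnerProductSpace ℝ E] [FiniteDimensional ℝ E]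
  [MeasurableSpace E] [BorelSpace E]

theorem integrable_norm_rpow_piecewise [Nontrivial E] {a b : ℝ} (ha : 0 < a) (hb : b < 0) :
    Integrable (fun z : E => (if ‖z‖ ≤ 1 then ‖z‖ ^ a else ‖z‖ ^ b) *
      ‖z‖ ^ (-(Module.finrank ℝ E : ℝ))) := by
  refine (integrable_fun_norm_addHaar (volume : Measure E) (f := fun r : ℝ =>
    (if r ≤ 1 then r ^ a else r ^ b) * r ^ (-(Module.finrank ℝ E : ℝ)))).2 ?_
  have hn : 1 ≤ Module.finrank ℝ E := Module.finrank_pos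
  have e : ∀ r : ℝ, 0 < r → ∀ p : ℝ,
      r ^ (Module.finrank ℝ E - 1) * (r ^ p * r ^ (-(Module.finrank ℝ E : ℝ))) = r ^ (p - 1) := by
    intro r hr p
    rw [← Real.rpow_natCast, ← Real.rpow_add hr, ← Real.rpow_add hr]
    congr 1
    push_cast [hn]
    ring
  rw [← Set.Ioc_union_Ioi_eq_Ioi zero_le_one]
  refine IntegrableOn.union ?_ ?_
  · have h := (intervalIntegral.intervalIntegrable_rpow' (a := 0) (b := 1) (r := a - 1)
      (by linarith)).1
    refine h.congr_fun (fun r hr => ?_) measurableSet_Ioc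
    simp only [smul_eq_mul, if_pos hr.2, e r hr.1]
  · have h := integrableOn_Ioi_rpow_of_lt (a := b - 1) (c := 1) (by linarith) one_pos
    refine h.congr_fun (fun r hr => ?_) measurableSet_Ioi
    simp only [smul_eq_mul, if_neg (not_le.2 (Set.mem_Ioi.1 hr)), e r (one_pos.trans (Set.mem_Ioi.1 hr))]

/-- The Lévy measure of the isotropic stable process, with intensity `c`. -/
noncomputable def stableMeasure (E : Type*) [NormedAddCommGroup E] [InnerProductSpace ℝ E]
    [FiniteDimensional ℝ E] [MeasurableSpace E] [BorelSpace E] (α c : ℝ) : Measure E :=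
  volume.withDensity fun z => ENNReal.ofReal (c * ‖z‖ ^ (-((Module.finrank ℝ E : ℝ) + α)))

theorem measurable_stableDensity (α c : ℝ) : Measurable
    fun z : E => ENNReal.ofReal (c * ‖z‖ ^ (-((Module.finrank ℝ E : ℝ) + α))) := by
  fun_prop

theorem integrable_stableMeasure_iff {α c : ℝ} (hc : 0 ≤ c) {g : E → ℝ} :
    Integrable g (stableMeasure E α c) ↔
      Integrable fun z => c * ‖z‖ ^ (-((Module.finrank ℝ E : ℝ) + α)) * g z := by
  rw [stableMeasure, integrable_withDensity_iff_integrable_smul' (measurable_stableDensity α c)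
    (Eventually.of_forall fun _ => ENNReal.ofReal_lt_top)]
  refine integrable_congr (Eventually.of_forall fun z => ?_)
  simp only [smul_eq_mul]
  rw [ENNReal.toReal_ofReal (by positivity)]

theorem integral_stableMeasure {α c : ℝ} (hc : 0 ≤ c) (g : E → ℝ) :
    ∫ z, g z ∂(stableMeasure E α c) =
      ∫ z, c * ‖z‖ ^ (-((Module.finrank ℝ E : ℝ) + α)) * g z := by
  rw [stableMeasure, integral_withDensity_eq_integral_toReal_smul (measurable_stableDensity α c)
    (Eventually.of_forall fun _ => ENNReal.ofReal_lt_top)]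
  refine integral_congr_ae (Eventually.of_forall fun z => ?_)
  simp only [smul_eq_mul]
  rw [ENNReal.toReal_ofReal (by positivity)]

theorem integrable_stableMeasure_of_le [Nontrivial E] {α c : ℝ} (hc : 0 ≤ c) {g : E → ℝ}
    (hg : Measurable g) {a b C : ℝ} (ha : α < a) (hb : b < α)
    (h : ∀ z, |g z| ≤ C * (if ‖z‖ ≤ 1 then ‖z‖ ^ a else ‖z‖ ^ b)) :
    Integrable g (stableMeasure E α c) := by
  rw [integrable_stableMeasure_iff hc]
  refine ((integrable_norm_rpow_piecewise (E := E) (sub_pos.2 ha) (sub_neg.2 hb)).const_mul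
    (c * C)).mono' (by fun_prop) ?_
  filter_upwards [compl_mem_ae_iff.2 (measure_singleton (μ := (volume : Measure E)) 0)] with z hz
  have hz : 0 < ‖z‖ := norm_pos_iff.2 hz
  have e : ∀ p : ℝ, ‖z‖ ^ (-((Module.finrank ℝ E : ℝ) + α)) * ‖z‖ ^ p =
      ‖z‖ ^ (p - α) * ‖z‖ ^ (-(Module.finrank ℝ E : ℝ)) := fun p => by
    rw [← Real.rpow_add hz, ← Real.rpow_add hz]
    ring_nf
  rw [norm_mul, Real.norm_of_nonneg (by positivity)]
  calc _ ≤ c * ‖z‖ ^ (-((Module.finrank ℝ E : ℝ) + α)) *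
        (C * (if ‖z‖ ≤ 1 then ‖z‖ ^ a else ‖z‖ ^ b)) :=
        mul_le_mul_of_nonneg_left (h z) (by positivity)
    _ = c * C * (‖z‖ ^ (-((Module.finrank ℝ E : ℝ) + α)) *
        (if ‖z‖ ≤ 1 then ‖z‖ ^ a else ‖z‖ ^ b)) := by ring
    _ = _ := by
      split_ifs
      · rw [e]
      · rw [e]

theorem integrable_one_sub_cos_stableMeasure [Nontrivial E] {α c : ℝ} (hα : α ∈ Set.Ioo (0 : ℝ) 2)
    (hc : 0 ≤ c) (ζ : E) :
    Integrable (fun z : E => 1 - Real.cos ⟪ζ, z⟫) (stableMeasure E α c) := by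
  refine integrable_stableMeasure_of_le hc (by fun_prop) (a := 2) (b := 0) (C := 2 + ‖ζ‖ ^ 2)
    hα.2 hα.1 fun z => ?_
  have h1 := Real.one_sub_sq_div_two_le_cos (x := ⟪ζ, z⟫)
  have h2 := Real.cos_le_one ⟪ζ, z⟫
  have h3 := Real.neg_one_le_cos ⟪ζ, z⟫
  have h4 : ⟪ζ, z⟫ ^ 2 ≤ (‖ζ‖ * ‖z‖) ^ 2 := by
    have := abs_real_inner_le_norm ζ z
    exact sq_le_sq' (by linarith [abs_le.1 this]) (abs_le.1 this).2
  rw [abs_of_nonneg (by linarith)]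
  split_ifs with h
  · rw [Real.rpow_two]
    rw [mul_pow] at h4
    nlinarith [sq_nonneg ‖z‖, sq_nonneg ⟪ζ, z⟫]
  · rw [Real.rpow_zero]
    nlinarith [sq_nonneg ‖ζ‖]

/-- The Lévy–Khintchine formula for the isotropic stable process. -/
theorem exists_integral_one_sub_cos_stableMeasure [Nontrivial E] {α : ℝ}
    (hα : α ∈ Set.Ioo (0 : ℝ) 2) :
    ∃ c, 0 < c ∧ ∀ ζ : E, ∫ z, (1 - Real.cos ⟪ζ, z⟫) ∂(stableMeasure E α c) = ‖ζ‖ ^ α := by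
  set n : ℝ := (Module.finrank ℝ E : ℝ) with hn
  set H : E → ℝ := fun ζ => ∫ z : E, ‖z‖ ^ (-(n + α)) * (1 - Real.cos ⟪ζ, z⟫) with hH
  have h_int : ∀ ζ : E, Integrable fun z : E => ‖z‖ ^ (-(n + α)) * (1 - Real.cos ⟪ζ, z⟫) :=
    fun ζ => by
      have := (integrable_stableMeasure_iff zero_le_one).1
        (integrable_one_sub_cos_stableMeasure hα zero_le_one ζ)
      simpa using this
  have hscale : ∀ (r : ℝ) (ζ : E), 0 < r → H (r • ζ) = r ^ α * H ζ := by
    intro r ζ hr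
    have h := Measure.integral_comp_smul (volume : Measure E)
      (fun z : E => ‖z‖ ^ (-(n + α)) * (1 - Real.cos ⟪ζ, z⟫)) r
    have h1 : ∀ z : E, ‖r • z‖ ^ (-(n + α)) * (1 - Real.cos ⟪ζ, r • z⟫) =
        r ^ (-(n + α)) * (‖z‖ ^ (-(n + α)) * (1 - Real.cos ⟪r • ζ, z⟫)) := fun z => by
      rw [norm_smul, Real.norm_of_nonneg hr.le, Real.mul_rpow hr.le (norm_nonneg _),
        real_inner_smul_left, real_inner_smul_right]
      ring
    simp only [h1, integral_const_mul, smul_eq_mul] at h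
    rw [abs_of_pos (by positivity), ← Real.rpow_natCast, ← hn, ← Real.rpow_neg hr.le] at h
    have h2 : H (r • ζ) = r ^ (n + α) * (r ^ (-(n + α)) * H (r • ζ)) := by
      rw [← mul_assoc, ← Real.rpow_add hr]; simp
    rw [h2]
    simp only [hH] at h ⊢
    rw [h, ← mul_assoc, ← Real.rpow_add hr]
    ring_nf
  have hrot : ∀ ζ ζ' : E, ‖ζ‖ = ‖ζ'‖ → H ζ = H ζ' := by
    intro ζ ζ' h
    set R := (ℝ ∙ (ζ - ζ'))ᗮ.reflection with hR
    have hRζ : R ζ = ζ' := Submodule.reflection_sub h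
    have := R.measurePreserving.integral_comp R.toHomeomorph.measurableEmbedding
      (fun z : E => ‖z‖ ^ (-(n + α)) * (1 - Real.cos ⟪ζ', z⟫))
    simp only [hH]
    rw [← this]
    refine integral_congr_ae (Eventually.of_forall fun z => ?_)
    simp only [LinearIsometryEquiv.norm_map]
    rw [← hRζ, LinearIsometryEquiv.inner_map_map]
  obtain ⟨e, he⟩ := exists_norm_eq E (zero_le_one' ℝ)
  have hpos : 0 < H e := by
    refine (integral_pos_iff_support_of_nonneg (fun z => ?_) (h_int e)).2 ?_
    · have := Real.cos_le_one ⟪e, z⟫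
      have : 0 ≤ 1 - Real.cos ⟪e, z⟫ := by linarith
      positivity
    · have ho : IsOpen {z : E | 0 < ⟪e, z⟫ ∧ ⟪e, z⟫ < 1} :=
        by
        have hcont : Continuous fun z : E => ⟪e, z⟫ := by fun_prop
        exact (isOpen_lt continuous_const hcont).inter (isOpen_lt hcont continuous_const)
      refine lt_of_lt_of_le (ho.measure_pos volume ⟨(1 / 2 : ℝ) • e, ?_⟩) (measure_mono ?_)
      · simp only [Set.mem_ofPred_eq, real_inner_smul_right, real_inner_self_eq_norm_sq, he]
        norm_num
      · rintro z ⟨h0, h1⟩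
        have hz : z ≠ 0 := by rintro rfl; simp at h0
        have hz : 0 < ‖z‖ := norm_pos_iff.2 hz
        have : Real.cos ⟪e, z⟫ < 1 := by
          rw [← Real.cos_zero]
          exact Real.cos_lt_cos_of_nonneg_of_le_pi le_rfl (by linarith [Real.pi_gt_three]) h0
        have : 0 < 1 - Real.cos ⟪e, z⟫ := by linarith
        exact ne_of_gt (by positivity)
  refine ⟨(H e)⁻¹, inv_pos.2 hpos, fun ζ => ?_⟩
  rw [integral_stableMeasure (inv_pos.2 hpos).le]
  simp only [mul_assoc, integral_const_mul]
  change (H e)⁻¹ * H ζ = _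
  rcases eq_or_ne ζ 0 with rfl | hζ
  · simp [hH, Real.zero_rpow hα.1.ne']
  · have hζ' : 0 < ‖ζ‖ := norm_pos_iff.2 hζ
    rw [hrot ζ (‖ζ‖ • e) (by simp [norm_smul, he]), hscale _ _ hζ']
    field_simp

end Stable

section Jump

variable {E : Type*} [NormedAddCommGroup E] [InnerProductSpace ℝ E] [FiniteDimensional ℝ E]
  [MeasurableSpace E] [BorelSpace E]

/-- The image of `ds ⊗ κ(dz)` on `(0,1] × E` under `(s, z) ↦ (s z, z)`: the Lévy measure of the
pair (integrated process, process) at time one. -/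
noncomputable def jumpMeasure (κ : Measure E) : Measure (E × E) :=
  (((volume : Measure ℝ).restrict (Set.Ioc 0 1)).prod κ).map fun p => (p.1 • p.2, p.2)

theorem measurable_jumpMap : Measurable fun p : ℝ × E => (p.1 • p.2, p.2) := by
  fun_prop

theorem lintegral_jumpMeasure (κ : Measure E) [SFinite κ] {g : E × E → ℝ≥0∞} (hg : Measurable g) :
    ∫⁻ y, g y ∂(jumpMeasure κ) = ∫⁻ s in Set.Ioc (0 : ℝ) 1, ∫⁻ z, g (s • z, z) ∂κ := by
  rw [jumpMeasure, lintegral_map hg measurable_jumpMap, lintegral_prod]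
  exact (hg.comp measurable_jumpMap).aemeasurable

theorem jumpMeasure_univ (κ : Measure E) [SFinite κ] : jumpMeasure κ Set.univ = κ Set.univ := by
  rw [jumpMeasure, Measure.map_apply measurable_jumpMap MeasurableSet.univ, Set.preimage_univ,
    ← Set.univ_prod_univ, Measure.prod_prod]
  simp

instance isFiniteMeasure_jumpMeasure (κ : Measure E) [IsFiniteMeasure κ] :
    IsFiniteMeasure (jumpMeasure κ) :=
  ⟨by rw [jumpMeasure_univ]; exact measure_lt_top _ _⟩

instance isNegInvariant_jumpMeasure (κ : Measure E) [SFinite κ] [κ.IsNegInvariant] :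
    (jumpMeasure κ).IsNegInvariant := by
  constructor
  rw [Measure.neg, jumpMeasure, Measure.map_map measurable_neg measurable_jumpMap]
  have h1 : (Neg.neg ∘ fun p : ℝ × E => (p.1 • p.2, p.2)) =
      (fun p : ℝ × E => (p.1 • p.2, p.2)) ∘ Prod.map id Neg.neg := by
    ext p <;> simp
  have h2 : MeasurePreserving (Prod.map id Neg.neg : ℝ × E → ℝ × E)
      (((volume : Measure ℝ).restrict (Set.Ioc 0 1)).prod κ)
      (((volume : Measure ℝ).restrict (Set.Ioc 0 1)).prod κ) :=
    (MeasurePreserving.id _).prod (Measure.measurePreserving_neg κ)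
  rw [h1, ← Measure.map_map measurable_jumpMap h2.measurable, h2.map_eq]

theorem jumpMeasure_restrict_add_compl (κ : Measure E) [SFinite κ] {A : Set E}
    (hA : MeasurableSet A) :
    jumpMeasure (κ.restrict A) + jumpMeasure (κ.restrict Aᶜ) = jumpMeasure κ := by
  conv_rhs => rw [← Measure.restrict_add_restrict_compl (μ := κ) hA]
  rw [jumpMeasure, jumpMeasure, jumpMeasure, Measure.prod_add, Measure.map_add _ _
    measurable_jumpMap]

/-- The Lévy symbol with jump measure `κ` of the kinetic pair. -/
noncomputable def kineticSymbol (κ : Measure E) (w : E × E) : ℝ :=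
  ∫ y : E × E, (1 - Real.cos (⟪y.1, w.1⟫ + ⟪y.2, w.2⟫)) ∂(jumpMeasure κ)

theorem kineticSymbol_nonneg (κ : Measure E) (w : E × E) : 0 ≤ kineticSymbol κ w :=
  integral_nonneg fun _ => sub_nonneg.2 (Real.cos_le_one _)

theorem kineticSymbol_eq_sub_cosChar (κ : Measure E) [IsFiniteMeasure κ] (w : E × E) :
    kineticSymbol κ w = κ.real Set.univ - cosChar (jumpMeasure κ) w := by
  rw [kineticSymbol, integral_sub (integrable_const _), cosChar]
  · simp [Measure.real, jumpMeasure_univ]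
  · exact Integrable.of_bound (C := 1) (Continuous.aestronglyMeasurable (by fun_prop))
      (Eventually.of_forall fun z => Real.abs_cos_le_one _)

theorem continuous_kineticSymbol (κ : Measure E) [IsFiniteMeasure κ] :
    Continuous (kineticSymbol κ) := by
  simp only [funext (kineticSymbol_eq_sub_cosChar κ)]
  exact continuous_const.sub (continuous_cosChar _)

theorem kineticSymbol_le (κ : Measure E) [IsFiniteMeasure κ] (w : E × E) :
    kineticSymbol κ w ≤ 2 * κ.real Set.univ := by
  rw [kineticSymbol_eq_sub_cosChar]
  have := abs_cosChar_le (jumpMeasure κ) w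
  rw [Measure.real, jumpMeasure_univ] at this
  have := (abs_le.1 this).1
  simp only [Measure.real] at *
  linarith

instance sFinite_stableMeasure (α c : ℝ) : SFinite (stableMeasure E α c) := by
  unfold stableMeasure; infer_instance

theorem jump_inner_eq (s : ℝ) (z : E) (w : E × E) :
    ⟪s • z, w.1⟫ + ⟪z, w.2⟫ = ⟪s • w.1 + w.2, z⟫ := by
  rw [inner_add_left, real_inner_smul_left, real_inner_smul_left, real_inner_comm, real_inner_comm
    w.2]

theorem continuous_norm_smul_add_rpow {α : ℝ} (hα : 0 ≤ α) (w : E × E) :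
    Continuous fun s : ℝ => ‖s • w.1 + w.2‖ ^ α :=
  (Continuous.norm (by fun_prop)).rpow_const fun _ => Or.inr hα

theorem kineticSymbol_stableMeasure [Nontrivial E] {α c : ℝ} (hα : α ∈ Set.Ioo (0 : ℝ) 2)
    (hc : 0 ≤ c)
    (h : ∀ ζ : E, ∫ z, (1 - Real.cos ⟪ζ, z⟫) ∂(stableMeasure E α c) = ‖ζ‖ ^ α) (w : E × E) :
    Integrable (fun y : E × E => 1 - Real.cos (⟪y.1, w.1⟫ + ⟪y.2, w.2⟫))
        (jumpMeasure (stableMeasure E α c)) ∧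
      kineticSymbol (stableMeasure E α c) w = ∫ s in (0 : ℝ)..1, ‖s • w.1 + w.2‖ ^ α := by
  have h_int : Integrable (fun p : ℝ × E => 1 - Real.cos (⟪p.1 • p.2, w.1⟫ + ⟪p.2, w.2⟫))
      (((volume : Measure ℝ).restrict (Set.Ioc 0 1)).prod (stableMeasure E α c)) := by
    refine (integrable_prod_iff (Continuous.aestronglyMeasurable (by fun_prop))).2 ⟨?_, ?_⟩
    · refine Eventually.of_forall fun s => ?_
      simp only [jump_inner_eq]
      exact integrable_one_sub_cos_stableMeasure hα hc _
    · have : ∀ (s : ℝ) (z : E), ‖1 - Real.cos (⟪s • z, w.1⟫ + ⟪z, w.2⟫)‖ =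
          1 - Real.cos ⟪s • w.1 + w.2, z⟫ := fun s z => by
        rw [jump_inner_eq, Real.norm_of_nonneg (sub_nonneg.2 (Real.cos_le_one _))]
      simp only [this, h]
      exact ((continuous_norm_smul_add_rpow hα.1.le w).integrableOn_Icc).mono_set
        Set.Ioc_subset_Icc_self
  have hc' : Continuous fun y : E × E => 1 - Real.cos (⟪y.1, w.1⟫ + ⟪y.2, w.2⟫) := by fun_prop
  constructor
  · exact (integrable_map_measure hc'.aestronglyMeasurable
      measurable_jumpMap.aemeasurable).2 h_int
  · rw [kineticSymbol, jumpMeasure, integral_map measurable_jumpMap.aemeasurable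
      hc'.aestronglyMeasurable, integral_prod _ h_int, intervalIntegral.integral_of_le zero_le_one]
    simp only [jump_inner_eq, h]

theorem kineticSymbol_restrict_add_compl {κ : Measure E} [SFinite κ] {A : Set E}
    (hA : MeasurableSet A) {w : E × E}
    (hi : Integrable (fun y : E × E => 1 - Real.cos (⟪y.1, w.1⟫ + ⟪y.2, w.2⟫)) (jumpMeasure κ)) :
    kineticSymbol (κ.restrict A) w + kineticSymbol (κ.restrict Aᶜ) w = kineticSymbol κ w := by
  rw [← jumpMeasure_restrict_add_compl κ hA] at hi
  rw [kineticSymbol, kineticSymbol, kineticSymbol, ← jumpMeasure_restrict_add_compl κ hA,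
    integral_add_measure hi.left_of_add_measure hi.right_of_add_measure]

theorem isNegInvariant_stableMeasure_restrict (α c : ℝ) {A : Set E} (hA : MeasurableSet A)
    (hA' : ∀ z, -z ∈ A ↔ z ∈ A) : ((stableMeasure E α c).restrict A).IsNegInvariant := by
  constructor
  rw [Measure.neg]
  ext B hB
  rw [Measure.map_apply measurable_neg hB, Measure.restrict_apply (measurable_neg hB),
    Measure.restrict_apply hB, stableMeasure, withDensity_apply _ ((measurable_neg hB).inter hA),
    withDensity_apply _ (hB.inter hA)]
  rw [← (Measure.measurePreserving_neg (volume : Measure E)).setLIntegral_comp_preimage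
    (hB.inter hA) (measurable_stableDensity α c)]
  have : Neg.neg ⁻¹' B ∩ A = Neg.neg ⁻¹' (B ∩ A) := by
    ext z
    simp [hA']
  rw [this]
  simp only [norm_neg]

theorem isFiniteMeasure_stableMeasure_restrict [Nontrivial E] {α c : ℝ}
    (hα : α ∈ Set.Ioo (0 : ℝ) 2) (hc : 0 ≤ c) {ε : ℝ} (hε : 0 < ε) {A : Set E}
    (hA : A ⊆ {z | ε ≤ ‖z‖}) :
    IsFiniteMeasure ((stableMeasure E α c).restrict A) := by
  have hm : MeasurableSet {z : E | ε ≤ ‖z‖} := measurableSet_le measurable_const measurable_norm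
  constructor
  rw [Measure.restrict_apply_univ]
  refine (measure_mono hA).trans_lt ?_
  have : Integrable ({z : E | ε ≤ ‖z‖}.indicator fun _ => (1 : ℝ)) (stableMeasure E α c) := by
    refine integrable_stableMeasure_of_le hc (measurable_const.indicator hm) (a := 2) (b := 0)
      (C := 1 + (ε ^ 2)⁻¹) hα.2 hα.1 fun z => ?_
    have h1 : 0 < (ε ^ 2)⁻¹ := by positivity
    by_cases hz : z ∈ {z : E | ε ≤ ‖z‖}
    · rw [Set.indicator_of_mem hz, abs_one]
      split_ifs with h
      · have hz : ε ≤ ‖z‖ := hz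
        rw [Real.rpow_two]
        have h2 : ε ^ 2 ≤ ‖z‖ ^ 2 := by gcongr
        have h3 : (ε ^ 2)⁻¹ * ε ^ 2 = 1 := by field_simp
        nlinarith [sq_nonneg ‖z‖]
      · simp only [Real.rpow_zero]; linarith
    · rw [Set.indicator_of_notMem hz, abs_zero]
      split_ifs <;> positivity
  rw [integrable_indicator_iff hm, integrableOn_const_iff] at this
  simpa using this

/-- The small-jump symbol is smooth with derivatives of at most quadratic growth. -/
theorem contDiff_kineticSymbol_ball [Nontrivial E] {α c : ℝ} (hα : α ∈ Set.Ioo (0 : ℝ) 2)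
    (hc : 0 ≤ c) :
    ContDiff ℝ (⊤ : ℕ∞) (kineticSymbol ((stableMeasure E α c).restrict {z | 1 ≤ ‖z‖}ᶜ)) ∧
      ∃ K : ℕ → ℝ, ∀ n w, ‖iteratedFDeriv ℝ n
        (kineticSymbol ((stableMeasure E α c).restrict {z | 1 ≤ ‖z‖}ᶜ)) w‖ ≤
        K n * (1 + ‖w‖) ^ 2 := by
  set κ := (stableMeasure E α c).restrict {z | 1 ≤ ‖z‖}ᶜ with hκ
  have hm : MeasurableSet {z : E | 1 ≤ ‖z‖} := measurableSet_le measurable_const measurable_norm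
  have hL : ∀ y : E × E, ‖phasePairing E y‖ ≤ 2 * ‖y‖ := fun y =>
    ContinuousLinearMap.opNorm_le_bound _ (by positivity) fun w => by
      rw [phasePairing_apply, Real.norm_eq_abs]
      refine (abs_add_le _ _).trans ?_
      have h1 := (abs_real_inner_le_norm y.1 w.1).trans
        (mul_le_mul (norm_fst_le y) (norm_fst_le w) (norm_nonneg _) (norm_nonneg _))
      have h2 := (abs_real_inner_le_norm y.2 w.2).trans
        (mul_le_mul (norm_snd_le y) (norm_snd_le w) (norm_nonneg _) (norm_nonneg _))
      linarith
  have hsm : ∀ᵐ p ∂(((volume : Measure ℝ).restrict (Set.Ioc 0 1)).prod κ),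
      ‖(p.1 • p.2, p.2)‖ ≤ ‖p.2‖ ∧ ‖p.2‖ ≤ 1 := by
    have h1 : ∀ᵐ p ∂(((volume : Measure ℝ).restrict (Set.Ioc 0 1)).prod κ),
        p.1 ∈ Set.Ioc (0 : ℝ) 1 :=
      Measure.quasiMeasurePreserving_fst.ae (ae_restrict_mem measurableSet_Ioc)
    have h2 : ∀ᵐ p ∂(((volume : Measure ℝ).restrict (Set.Ioc 0 1)).prod κ),
        p.2 ∈ {z : E | 1 ≤ ‖z‖}ᶜ :=
      Measure.quasiMeasurePreserving_snd.ae (ae_restrict_mem hm.compl)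
    filter_upwards [h1, h2] with p hp1 hp2
    have h3 : ‖p.2‖ < 1 := not_le.1 hp2
    refine ⟨?_, h3.le⟩
    rw [Prod.norm_def, max_le_iff]
    refine ⟨?_, le_rfl⟩
    rw [norm_smul, Real.norm_of_nonneg hp1.1.le]
    exact mul_le_of_le_one_left (norm_nonneg _) hp1.2
  have := contDiff_integral_one_sub_cos (m := jumpMeasure κ) (L := fun y => phasePairing E y)
    (phasePairing E).continuous.aestronglyMeasurable ?_ ?_
  · simp only [phasePairing_apply] at this
    exact this
  · refine (integrable_map_measure (Continuous.aestronglyMeasurable (by fun_prop))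
      measurable_jumpMap.aemeasurable).2 ?_
    have hz : Integrable (fun z : E => ‖z‖ ^ 2) κ := by
      have : Integrable (({z : E | 1 ≤ ‖z‖}ᶜ).indicator fun z => ‖z‖ ^ 2)
          (stableMeasure E α c) := by
        refine integrable_stableMeasure_of_le hc
          (Measurable.indicator (by fun_prop) hm.compl) (a := 2) (b := 0) (C := 1)
          hα.2 hα.1 fun z => ?_
        by_cases hz : z ∈ {z : E | 1 ≤ ‖z‖}ᶜ
        · have h3 : ‖z‖ < 1 := not_le.1 hz
          rw [Set.indicator_of_mem hz, if_pos h3.le, Real.rpow_two, one_mul,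
            abs_of_nonneg (by positivity)]
        · rw [Set.indicator_of_notMem hz, abs_zero]
          split_ifs <;> positivity
      exact (integrable_indicator_iff hm.compl).1 this
    have hz2 : Integrable (fun p : ℝ × E => 4 * ‖p.2‖ ^ 2)
        (((volume : Measure ℝ).restrict (Set.Ioc 0 1)).prod κ) :=
      (hz.comp_snd _).const_mul 4
    refine hz2.mono' (Continuous.aestronglyMeasurable (by fun_prop)) ?_
    filter_upwards [hsm] with p hp
    rw [Function.comp_apply, Real.norm_of_nonneg (sq_nonneg _)]
    have := (hL (p.1 • p.2, p.2)).trans (mul_le_mul_of_nonneg_left hp.1 zero_le_two)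
    calc _ ≤ (2 * ‖p.2‖) ^ 2 := pow_le_pow_left₀ (norm_nonneg _) this 2
      _ = _ := by ring
  · rw [jumpMeasure, ae_map_iff measurable_jumpMap.aemeasurable
      (measurableSet_le (by fun_prop) measurable_const)]
    filter_upwards [hsm] with p hp
    linarith [hL (p.1 • p.2, p.2), hp.1, hp.2]

/-- Coercivity of the symbol, by homogeneity and compactness. -/
theorem exists_mul_norm_rpow_le_integral [Nontrivial E] {α : ℝ} (hα : 0 < α) :
    ∃ a, 0 < a ∧ ∀ w : E × E, a * ‖w‖ ^ α ≤ ∫ s in (0 : ℝ)..1, ‖s • w.1 + w.2‖ ^ α := by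
  set Ψ : E × E → ℝ := fun w => ∫ s in (0 : ℝ)..1, ‖s • w.1 + w.2‖ ^ α with hΨ
  have hcont : Continuous Ψ := by
    refine intervalIntegral.continuous_parametric_intervalIntegral_of_continuous' ?_ 0 1
    exact (Continuous.norm (by fun_prop)).rpow_const fun _ => Or.inr hα.le
  have hpos : ∀ w, w ≠ 0 → 0 < Ψ w := by
    intro w hw
    refine intervalIntegral.integral_pos zero_lt_one
      (continuous_norm_smul_add_rpow hα.le w).continuousOn (fun s _ => by positivity) ?_
    by_cases h2 : w.2 = 0
    · have h1 : w.1 ≠ 0 := fun h1 => hw (Prod.ext h1 h2)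
      refine ⟨1, by simp, Real.rpow_pos_of_pos (norm_pos_iff.2 ?_) _⟩
      simpa [h2] using h1
    · refine ⟨0, by simp, Real.rpow_pos_of_pos (norm_pos_iff.2 ?_) _⟩
      simpa using h2
  have hhom : ∀ (r : ℝ) w, 0 ≤ r → Ψ (r • w) = r ^ α * Ψ w := by
    intro r w hr
    simp only [hΨ]
    rw [← intervalIntegral.integral_const_mul]
    refine intervalIntegral.integral_congr fun s _ => ?_
    simp only [Prod.smul_fst, Prod.smul_snd]
    rw [smul_comm, ← smul_add, norm_smul, Real.norm_of_nonneg hr, Real.mul_rpow hr (norm_nonneg _)]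
  obtain ⟨w₀, hw₀, hmin⟩ := (isCompact_sphere (0 : E × E) 1).exists_isMinOn
    (NormedSpace.sphere_nonempty.2 zero_le_one) hcont.continuousOn
  have hw₀' : w₀ ≠ 0 := by
    rintro rfl
    simp at hw₀
  refine ⟨Ψ w₀, hpos _ hw₀', fun w => ?_⟩
  change _ ≤ Ψ w
  rcases eq_or_ne w 0 with rfl | hw
  · rw [norm_zero, Real.zero_rpow hα.ne', mul_zero]
    exact intervalIntegral.integral_nonneg zero_le_one fun s _ => by positivity
  · have hw' : 0 < ‖w‖ := norm_pos_iff.2 hw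
    have h1 : Ψ w = ‖w‖ ^ α * Ψ (‖w‖⁻¹ • w) := by
      rw [← hhom _ _ hw'.le, smul_smul, mul_inv_cancel₀ hw'.ne', one_smul]
    rw [h1, mul_comm]
    gcongr
    exact hmin (by simp [norm_smul, hw'.ne'])

end Jump

section Positivity

variable {E : Type*} [NormedAddCommGroup E] [InnerProductSpace ℝ E] [FiniteDimensional ℝ E]
  [MeasurableSpace E] [BorelSpace E]

theorem exists_pow_mul_exp_neg_rpow_le {a α : ℝ} (ha : 0 < a) (hα : 0 < α) (k : ℕ) :
    ∃ M, 0 ≤ M ∧ ∀ r : ℝ, 0 ≤ r → (1 + r) ^ k * Real.exp (-(a * r ^ α)) ≤ M := by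
  obtain ⟨m, hm⟩ := exists_nat_ge ((k : ℝ) / α)
  rw [div_le_iff₀ hα] at hm
  refine ⟨2 ^ k * (1 + m.factorial / a ^ m), by positivity, fun r hr => ?_⟩
  have h0 : (0 : ℝ) ≤ m.factorial / a ^ m := by positivity
  rcases le_total r 1 with h | h
  · have h1 : Real.exp (-(a * r ^ α)) ≤ 1 := Real.exp_le_one_iff.2 (by
      have : 0 ≤ a * r ^ α := by positivity
      linarith)
    calc _ ≤ (2 : ℝ) ^ k * 1 := by gcongr; linarith
      _ ≤ _ := by gcongr; linarith
  · have hr0 : 0 < r := by linarith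
    have hx : 0 < a * r ^ α := by positivity
    have h1 : Real.exp (-(a * r ^ α)) ≤ m.factorial / (a * r ^ α) ^ m := by
      rw [Real.exp_neg, inv_le_comm₀ (Real.exp_pos _) (by positivity), inv_div]
      exact Real.pow_div_factorial_le_exp _ hx.le m
    have h2 : r ^ k ≤ (r ^ α) ^ m := by
      rw [← Real.rpow_natCast, ← Real.rpow_natCast, ← Real.rpow_mul hr]
      exact Real.rpow_le_rpow_of_exponent_le h (by linarith)
    calc _ ≤ (2 * r) ^ k * (m.factorial / (a * r ^ α) ^ m) := by gcongr; linarith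
      _ = 2 ^ k * (m.factorial / a ^ m) * (r ^ k / (r ^ α) ^ m) := by
        rw [mul_pow, mul_pow]; field_simp
      _ ≤ 2 ^ k * (m.factorial / a ^ m) * 1 := by
        gcongr
        exact (div_le_one (by positivity)).2 h2
      _ ≤ _ := by rw [mul_one]; gcongr; linarith

theorem integrable_pow_mul_exp_neg {ψ : E × E → ℝ} (hψ : Continuous ψ) {a α b : ℝ} (ha : 0 < a)
    (hα : 0 < α) (h : ∀ w, a * ‖w‖ ^ α - b ≤ ψ w) (k : ℕ) :
    Integrable fun w => (1 + ‖w‖) ^ k * Real.exp (-ψ w) := by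
  set N := Module.finrank ℝ (E × E) + 1 with hN
  obtain ⟨M, hM0, hM⟩ := exists_pow_mul_exp_neg_rpow_le ha hα (k + N)
  have hi := integrable_one_add_norm (μ := (volume : Measure (E × E))) (r := N)
    (by rw [hN]; push_cast; linarith)
  refine (hi.const_mul (Real.exp b * M)).mono' (Continuous.aestronglyMeasurable (by fun_prop))
    (Eventually.of_forall fun w => ?_)
  have h1 : (0 : ℝ) < (1 + ‖w‖) ^ N := by positivity
  rw [Real.norm_of_nonneg (by positivity), Real.rpow_neg (by positivity), Real.rpow_natCast,
    ← div_eq_mul_inv, le_div_iff₀ h1]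
  have h2 : Real.exp (-ψ w) ≤ Real.exp b * Real.exp (-(a * ‖w‖ ^ α)) := by
    rw [← Real.exp_add]
    exact Real.exp_le_exp.2 (by linarith [h w])
  calc _ = (1 + ‖w‖) ^ (k + N) * Real.exp (-ψ w) := by rw [pow_add]; ring
    _ ≤ (1 + ‖w‖) ^ (k + N) * (Real.exp b * Real.exp (-(a * ‖w‖ ^ α))) := by gcongr
    _ = Real.exp b * ((1 + ‖w‖) ^ (k + N) * Real.exp (-(a * ‖w‖ ^ α))) := by ring
    _ ≤ _ := by gcongr; exact hM _ (norm_nonneg _)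

theorem cosTransform_nonneg_of_tendsto {f : ℕ → E × E → ℝ} {φ g : E × E → ℝ}
    (hf : ∀ n, Continuous (f n)) (hg : Integrable g) (hfg : ∀ n w, |f n w| ≤ g w)
    (hlim : ∀ w, Tendsto (fun n => f n w) atTop (𝓝 (φ w))) {y : E × E}
    (h0 : ∀ n, 0 ≤ cosTransform (f n) y) : 0 ≤ cosTransform φ y := by
  refine ge_of_tendsto' (tendsto_integral_of_dominated_convergence g (fun n => ?_) hg
    (fun n => Eventually.of_forall fun w => ?_)
    (Eventually.of_forall fun w => (hlim w).const_mul _)) h0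
  · exact Continuous.aestronglyMeasurable (by fun_prop)
  · rw [norm_mul]
    exact (mul_le_of_le_one_left (norm_nonneg _) (Real.abs_cos_le_one _)).trans (hfg n w)

/-- The Gaussian symbol on the phase space. -/
noncomputable def gaussianSymbol (δ : ℝ) (w : E × E) : ℝ :=
  Real.exp (-δ * ‖w.1‖ ^ 2) * Real.exp (-δ * ‖w.2‖ ^ 2)

theorem integrable_gaussianSymbol {δ : ℝ} (hδ : 0 < δ) :
    Integrable (gaussianSymbol δ : E × E → ℝ) := by
  have : Integrable fun v : E => Real.exp (-δ * ‖v‖ ^ 2) := by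
    have := (GaussianFourier.integrable_cexp_neg_mul_sq_norm_add (V := E) (b := δ)
      (by simpa using hδ) 0 0).norm
    refine this.congr (Eventually.of_forall fun v => ?_)
    simp [Complex.norm_exp, ← Complex.ofReal_pow]
  exact this.mul_prod this

theorem cosTransform_gaussianSymbol_nonneg {δ : ℝ} (hδ : 0 < δ) (y : E × E) :
    0 ≤ cosTransform (gaussianSymbol δ) y := by
  set f : E → E → ℂ := fun x v => Complex.exp (-(δ : ℂ) * ‖v‖ ^ 2 + Complex.I * ⟪x, v⟫) with hf
  have hfi : ∀ x, Integrable (f x) := fun x =>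
    GaussianFourier.integrable_cexp_neg_mul_sq_norm_add (V := E) (b := δ)
      (by simpa using hδ) Complex.I x
  have hfe : ∀ x, ∫ v, f x v = (((π / δ) ^ (Module.finrank ℝ E / 2 : ℝ) *
      Real.exp (-‖x‖ ^ 2 / (4 * δ)) : ℝ) : ℂ) := fun x => by
    have h := GaussianFourier.integral_cexp_neg_mul_sq_norm_add (V := E) (b := δ)
      (by simpa using hδ) Complex.I x
    rw [hf]
    simp only
    rw [h]
    push_cast
    rw [Complex.ofReal_cpow (by positivity)]
    push_cast
    simp
  have h1 : cosTransform (gaussianSymbol δ) y = (∫ w : E × E, f y.1 w.1 * f y.2 w.2).re := by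
    refine Eq.trans ?_ (integral_re ((hfi y.1).mul_prod (hfi y.2)))
    refine integral_congr_ae (Eventually.of_forall fun w => ?_)
    simp only [hf, gaussianSymbol, RCLike.re_eq_complex_re]
    rw [← Complex.exp_add, Complex.exp_re, ← Real.exp_add, mul_comm]
    congr 2
    · simp [← Complex.ofReal_pow]
    · simp [← Complex.ofReal_pow]
  rw [h1]
  have := integral_prod_mul (μ := (volume : Measure E)) (ν := (volume : Measure E)) (f y.1) (f y.2)
  change 0 ≤ (∫ w : E × E, f y.1 w.1 * f y.2 w.2 ∂((volume : Measure E).prod volume)).re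
  rw [this, hfe, hfe, ← Complex.ofReal_mul, Complex.ofReal_re]
  positivity

theorem jumpMeasure_restrict (κ : Measure E) [SFinite κ] {A : Set E} (hA : MeasurableSet A) :
    jumpMeasure (κ.restrict A) = (jumpMeasure κ).restrict (Prod.snd ⁻¹' A) := by
  rw [jumpMeasure, jumpMeasure, Measure.restrict_map measurable_jumpMap (measurable_snd hA)]
  congr 1
  have := Measure.prod_restrict (μ := (volume : Measure ℝ).restrict (Set.Ioc 0 1)) (ν := κ)
    Set.univ A
  rw [Measure.restrict_univ] at this
  rw [this]
  congr 1
  ext p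
  simp

theorem exp_neg_kineticSymbol_eq (κ : Measure E) [IsFiniteMeasure κ] (w : E × E) :
    Real.exp (-kineticSymbol κ w) =
      Real.exp (-κ.real Set.univ) * Real.exp (cosChar (jumpMeasure κ) w) := by
  rw [kineticSymbol_eq_sub_cosChar, ← Real.exp_add]
  ring_nf

theorem cosTransform_const_mul (a : ℝ) (φ : E × E → ℝ) (y : E × E) :
    cosTransform (fun w => a * φ w) y = a * cosTransform φ y := by
  rw [cosTransform, cosTransform, ← integral_const_mul]
  refine integral_congr_ae (Eventually.of_forall fun w => ?_)
  simp only
  ring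

/-- The truncated (small-jump) law has a nonnegative density. -/
theorem cosTransform_exp_neg_kineticSymbol_ball_nonneg [Nontrivial E] {α c : ℝ}
    (hα : α ∈ Set.Ioo (0 : ℝ) 2) (hc : 0 ≤ c)
    (h : ∀ ζ : E, ∫ z, (1 - Real.cos ⟪ζ, z⟫) ∂(stableMeasure E α c) = ‖ζ‖ ^ α)
    (h_int : Integrable fun w : E × E =>
      Real.exp (-kineticSymbol ((stableMeasure E α c).restrict {z | 1 ≤ ‖z‖}ᶜ) w)) (y : E × E) :
    0 ≤ cosTransform (fun w : E × E =>
      Real.exp (-kineticSymbol ((stableMeasure E α c).restrict {z | 1 ≤ ‖z‖}ᶜ) w)) y := by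
  set κ := stableMeasure E α c with hκ
  set A : ℕ → Set E := fun n => {z | 1 / ((n : ℝ) + 1) ≤ ‖z‖ ∧ ‖z‖ < 1} with hA
  have hAm : ∀ n, MeasurableSet (A n) := fun n =>
    (measurableSet_le measurable_const measurable_norm).inter
      (measurableSet_lt measurable_norm measurable_const)
  have hm : MeasurableSet {z : E | 1 ≤ ‖z‖} := measurableSet_le measurable_const measurable_norm
  have : ∀ n, IsFiniteMeasure (κ.restrict (A n)) := fun n =>
    isFiniteMeasure_stableMeasure_restrict hα hc (ε := 1 / ((n : ℝ) + 1)) (by positivity)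
      fun z hz => hz.1
  have : ∀ n, (κ.restrict (A n)).IsNegInvariant := fun n =>
    isNegInvariant_stableMeasure_restrict α c (hAm n) fun z => by simp [hA]
  have hU : κ.restrict (⋃ n, A n) = κ.restrict {z | 1 ≤ ‖z‖}ᶜ := by
    refine Measure.restrict_congr_set ?_
    have h0 : ∀ᵐ z ∂κ, z ≠ 0 := by
      refine (withDensity_absolutelyContinuous _ _).ae_le ?_
      exact compl_mem_ae_iff.2 (measure_singleton (μ := (volume : Measure E)) 0)
    filter_upwards [h0] with z hz
    refine propext ?_
    change z ∈ (⋃ n, A n) ↔ z ∈ {z : E | 1 ≤ ‖z‖}ᶜ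
    rw [Set.mem_iUnion]
    constructor
    · rintro ⟨n, hn⟩
      exact not_le.2 hn.2
    · intro hz1
      obtain ⟨n, hn⟩ := exists_nat_one_div_lt (norm_pos_iff.2 hz)
      exact ⟨n, hn.le, not_le.1 hz1⟩
  have hlim : ∀ w, Tendsto (fun n => kineticSymbol (κ.restrict (A n)) w) atTop
      (𝓝 (kineticSymbol (κ.restrict {z | 1 ≤ ‖z‖}ᶜ) w)) := by
    intro w
    rw [← hU]
    simp only [kineticSymbol]
    rw [jumpMeasure_restrict κ (MeasurableSet.iUnion hAm), Set.preimage_iUnion]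
    simp only [jumpMeasure_restrict κ (hAm _)]
    refine tendsto_setIntegral_of_monotone (fun n => measurable_snd (hAm n)) ?_
      (kineticSymbol_stableMeasure hα hc h w).1.integrableOn
    intro n m hnm p hp
    refine ⟨le_trans ?_ hp.1, hp.2⟩
    have : (n : ℝ) ≤ m := by exact_mod_cast hnm
    exact one_div_le_one_div_of_le (by positivity) (by linarith)
  set ψ := kineticSymbol (κ.restrict {z | 1 ≤ ‖z‖}ᶜ) with hψ
  have hψc : Continuous ψ := (contDiff_kineticSymbol_ball hα hc).1.continuous
  have hψ0 : ∀ w, 0 ≤ ψ w := kineticSymbol_nonneg _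
  have hgc : ∀ δ : ℝ, Continuous (gaussianSymbol δ : E × E → ℝ) := fun δ => by
    unfold gaussianSymbol; fun_prop
  have hg0 : ∀ (δ : ℝ) (w : E × E), 0 ≤ gaussianSymbol δ w := fun δ w => by
    unfold gaussianSymbol; positivity
  have h_damped : ∀ δ : ℝ, 0 < δ → 0 ≤ cosTransform (fun w => gaussianSymbol δ w * Real.exp (-ψ w)) y := by
    intro δ hδ
    have hcn : ∀ n, Continuous (kineticSymbol (κ.restrict (A n))) := fun n =>
      continuous_kineticSymbol _
    refine cosTransform_nonneg_of_tendsto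
      (f := fun n w => gaussianSymbol δ w * Real.exp (-kineticSymbol (κ.restrict (A n)) w))
      (fun n => ?_) (integrable_gaussianSymbol hδ) (fun n w => ?_) (fun w => ?_) fun n => ?_
    · have := hgc δ
      have := hcn n
      fun_prop
    · rw [abs_of_nonneg (mul_nonneg (hg0 _ _) (Real.exp_pos _).le)]
      exact mul_le_of_le_one_right (hg0 _ _)
        (Real.exp_le_one_iff.2 (by linarith [kineticSymbol_nonneg (κ.restrict (A n)) w]))
    · exact ((Real.continuous_exp.tendsto _).comp (hlim w).neg).const_mul _
    · have e : (fun w => gaussianSymbol δ w * Real.exp (-kineticSymbol (κ.restrict (A n)) w)) =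
          fun w : E × E => Real.exp (-(κ.restrict (A n)).real Set.univ) *
            (gaussianSymbol δ w * Real.exp (cosChar (jumpMeasure (κ.restrict (A n))) w)) := by
        ext w
        rw [exp_neg_kineticSymbol_eq]
        ring
      rw [e, cosTransform_const_mul]
      exact mul_nonneg (Real.exp_pos _).le (cosTransform_mul_exp_cosChar_nonneg
        (integrable_gaussianSymbol hδ) (cosTransform_gaussianSymbol_nonneg hδ) _ y)
  refine cosTransform_nonneg_of_tendsto
    (f := fun n w => gaussianSymbol (1 / ((n : ℝ) + 1)) w * Real.exp (-ψ w))
    (fun n => ?_) h_int (fun n w => ?_) (fun w => ?_) fun n => h_damped _ (by positivity)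
  · have := hgc (1 / ((n : ℝ) + 1))
    fun_prop
  · rw [abs_of_nonneg (mul_nonneg (hg0 _ _) (Real.exp_pos _).le)]
    refine mul_le_of_le_one_left (Real.exp_pos _).le ?_
    have : (0 : ℝ) ≤ 1 / ((n : ℝ) + 1) := by positivity
    unfold gaussianSymbol
    rw [← Real.exp_add, Real.exp_le_one_iff]
    nlinarith [mul_nonneg this (sq_nonneg ‖w.1‖), mul_nonneg this (sq_nonneg ‖w.2‖)]
  · have hd : Tendsto (fun n : ℕ => 1 / ((n : ℝ) + 1)) atTop (𝓝 0) :=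
      tendsto_one_div_add_atTop_nhds_zero_nat
    have hcd : Continuous fun δ : ℝ => gaussianSymbol δ w * Real.exp (-ψ w) := by
      unfold gaussianSymbol; fun_prop
    have := (hcd.tendsto 0).comp hd
    simpa [gaussianSymbol, Function.comp_def] using this

end Positivity

section Expansion

variable {E : Type*} [NormedAddCommGroup E] [InnerProductSpace ℝ E] [FiniteDimensional ℝ E]
  [MeasurableSpace E] [BorelSpace E]

/-- The symbol of the kinetic heat kernel at time one. -/
noncomputable def kineticChar (α : ℝ) (w : E × E) : ℝ :=
  Real.exp (-∫ s in (0 : ℝ)..1, ‖s • w.1 + w.2‖ ^ α)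

theorem integrable_kineticChar [Nontrivial E] {α : ℝ} (hα : 0 < α) :
    Integrable (kineticChar α : E × E → ℝ) := by
  obtain ⟨a, ha, h⟩ := exists_mul_norm_rpow_le_integral (E := E) hα
  have hc : Continuous fun w : E × E => ∫ s in (0 : ℝ)..1, ‖s • w.1 + w.2‖ ^ α := by
    refine intervalIntegral.continuous_parametric_intervalIntegral_of_continuous' ?_ 0 1
    exact (Continuous.norm (by fun_prop)).rpow_const fun _ => Or.inr hα.le
  have := integrable_pow_mul_exp_neg hc ha hα (b := 0) (fun w => by simpa using h w) 0
  simp only [pow_zero, one_mul] at this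
  exact this

/-- Compound Poisson expansion of the kinetic heat kernel with respect to the large jumps. -/
theorem exists_poisson_expansion [Nontrivial E] {α : ℝ} (hα : α ∈ Set.Ioo (0 : ℝ) 2) :
    ∃ c > 0, ∃ Λ > 0, ∃ p : ℕ → E × E → ℝ≥0∞,
      (∀ n, Measurable (p n)) ∧
      (∀ n y, p (n + 1) y = ∫⁻ s in Set.Ioc (0 : ℝ) 1, ∫⁻ z in {z : E | 1 ≤ ‖z‖},
        p n (y.1 - s • z, y.2 - z) ∂(stableMeasure E α c)) ∧
      (∀ N : ℕ, ∃ C : ℝ, 0 ≤ C ∧ ∀ x v,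
        p 0 (x, v) ≤ ENNReal.ofReal (C * ((1 + ‖x‖) ^ N * (1 + ‖v‖) ^ N)⁻¹)) ∧
      (∃ r > 0, ∃ ε > 0, ∀ x v, ‖x‖ < r → ‖v‖ < r → ENNReal.ofReal ε ≤ p 0 (x, v)) ∧
      (∀ y : E × E, 0 ≤ cosTransform (kineticChar α) y) ∧
      ∀ y : E × E, ENNReal.ofReal (cosTransform (kineticChar α) y) =
        ENNReal.ofReal Λ * ∑' n : ℕ, ENNReal.ofReal (n.factorial : ℝ)⁻¹ * p n y := by
  obtain ⟨c, hc, h⟩ := exists_integral_one_sub_cos_stableMeasure (E := E) hα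
  set κ := stableMeasure E α c with hκ
  have hm : MeasurableSet {z : E | 1 ≤ ‖z‖} := measurableSet_le measurable_const measurable_norm
  have : IsFiniteMeasure (κ.restrict {z : E | 1 ≤ ‖z‖}) :=
    isFiniteMeasure_stableMeasure_restrict hα hc.le one_pos subset_rfl
  have : (κ.restrict {z : E | 1 ≤ ‖z‖}).IsNegInvariant :=
    isNegInvariant_stableMeasure_restrict α c hm fun z => by simp
  set κ₁ := κ.restrict {z : E | 1 ≤ ‖z‖} with hκ₁
  set ψ := kineticSymbol (κ.restrict {z : E | 1 ≤ ‖z‖}ᶜ) with hψ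
  set l := κ₁.real Set.univ with hl
  have hdec : ∀ w, kineticSymbol κ₁ w + ψ w = ∫ s in (0 : ℝ)..1, ‖s • w.1 + w.2‖ ^ α := fun w => by
    rw [← (kineticSymbol_stableMeasure hα hc.le h w).2]
    exact kineticSymbol_restrict_add_compl hm (kineticSymbol_stableMeasure hα hc.le h w).1
  obtain ⟨a, ha, hcoer⟩ := exists_mul_norm_rpow_le_integral (E := E) hα.1
  obtain ⟨hsm, K, hK⟩ := contDiff_kineticSymbol_ball (E := E) hα hc.le
  have hlow : ∀ w, a * ‖w‖ ^ α - 2 * l ≤ ψ w := fun w => by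
    linarith [hdec w, hcoer w, kineticSymbol_le κ₁ w]
  have hpoly := integrable_pow_mul_exp_neg hsm.continuous ha hα.1 hlow
  set φ : E × E → ℝ := fun w => Real.exp (-ψ w) with hφ
  have hφi : Integrable φ := by simpa using hpoly 0
  have hφs : ContDiff ℝ (⊤ : ℕ∞) φ := Real.contDiff_exp.comp hsm.neg
  have hφd : ∀ n, Integrable (fun w => ‖iteratedFDeriv ℝ n φ w‖) := fun n => by
    obtain ⟨D, hD0, hD⟩ := norm_iteratedFDeriv_exp_neg_le hsm hK n
    refine ((hpoly (2 * n)).const_mul D).mono'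
      (hφs.continuous_iteratedFDeriv (by exact_mod_cast le_top)).norm.aestronglyMeasurable
      (Eventually.of_forall fun w => ?_)
    rw [norm_norm, ← mul_assoc]
    exact hD w
  have hφ0 : ∀ y, 0 ≤ cosTransform φ y :=
    cosTransform_exp_neg_kineticSymbol_ball_nonneg hα hc.le h hφi
  set ν := jumpMeasure κ₁ with hν
  have hchar : kineticChar α = fun w : E × E => Real.exp (-l) * (φ w * Real.exp (cosChar ν w)) := by
    ext w
    rw [kineticChar, ← hdec w, neg_add, Real.exp_add, exp_neg_kineticSymbol_eq]
    ring
  have hcont : ∀ n, Continuous (cosTransform fun w => φ w * cosChar ν w ^ n) := fun n =>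
    continuous_cosTransform (integrable_mul_cosChar_pow hφi ν n)
  have hpos0 : ∀ n y, 0 ≤ cosTransform (fun w => φ w * cosChar ν w ^ n) y :=
    cosTransform_mul_cosChar_pow_nonneg hφi hφ0 ν
  have hmeas : ∀ n, Measurable fun y =>
      ENNReal.ofReal (cosTransform (fun w => φ w * cosChar ν w ^ n) y) := fun n =>
    (hcont n).measurable.ennreal_ofReal
  refine ⟨c, hc, Real.exp (-l), Real.exp_pos _,
    fun n y => ENNReal.ofReal (cosTransform (fun w => φ w * cosChar ν w ^ n) y), hmeas,
    fun n y => ?_, fun N => ?_, ?_, fun y => ?_, fun y => ?_⟩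
  · beta_reduce
    rw [ofReal_cosTransform_mul_cosChar_pow_succ hφi hφ0, hν, lintegral_jumpMeasure]
    · rfl
    · exact (hmeas n).comp (measurable_const.sub measurable_id)
  · obtain ⟨C, hC0, hC⟩ := exists_pow_mul_cosTransform_le hφs hφd N
    refine ⟨C, hC0, fun x v => ENNReal.ofReal_le_ofReal ?_⟩
    simp only [pow_zero, mul_one]
    rw [← div_eq_mul_inv, le_div_iff₀ (by positivity), mul_comm]
    refine le_trans ?_ (hC x v)
    gcongr
    exact le_abs_self _
  · have h0 : 0 < cosTransform φ 0 := by
      have : cosTransform φ 0 = ∫ w, φ w := by simp [cosTransform]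
      rw [this]
      refine (integral_pos_iff_support_of_nonneg (fun w => (Real.exp_pos _).le) hφi).2 ?_
      have : Function.support φ = Set.univ := Set.eq_univ_of_forall fun w => (Real.exp_pos _).ne'
      rw [this]
      exact isOpen_univ.measure_pos _ Set.univ_nonempty
    have h1 := (continuous_cosTransform hφi).continuousAt.eventually
      (lt_mem_nhds (half_lt_self h0))
    obtain ⟨r, hr, hball⟩ := Metric.eventually_nhds_iff.1 h1
    refine ⟨r, hr, _, half_pos h0, fun x v hx hv => ENNReal.ofReal_le_ofReal ?_⟩
    simp only [pow_zero, mul_one]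
    refine (hball ?_).le
    simp [hx, hv]
  · rw [hchar, cosTransform_const_mul]
    exact mul_nonneg (Real.exp_pos _).le (cosTransform_mul_exp_cosChar_nonneg hφi hφ0 ν y)
  · have hs := hasSum_cosTransform_mul_exp_cosChar hφi ν y
    rw [hchar, cosTransform_const_mul, ENNReal.ofReal_mul (Real.exp_pos _).le, ← hs.tsum_eq,
      ENNReal.ofReal_tsum_of_nonneg (fun n => mul_nonneg (by positivity) (hpos0 n y)) hs.summable]
    congr 1
    refine tsum_congr fun n => ?_
    rw [ENNReal.ofReal_mul (by positivity)]

end Expansion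

section Bracket

variable {E : Type*} [NormedAddCommGroup E] [InnerProductSpace ℝ E] [FiniteDimensional ℝ E]
  [MeasurableSpace E] [BorelSpace E]

/-- The weight `(1 + ‖v‖) ^ p`, as an extended nonnegative real. -/
noncomputable def bracket (p : ℝ) (v : E) : ℝ≥0∞ := ENNReal.ofReal ((1 + ‖v‖) ^ p)

theorem measurable_bracket (p : ℝ) : Measurable (bracket p : E → ℝ≥0∞) := by
  unfold bracket; fun_prop

theorem bracket_add (p r : ℝ) (v : E) : bracket (p + r) v = bracket p v * bracket r v := by
  have h : 0 < 1 + ‖v‖ := by positivity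
  rw [bracket, Real.rpow_add h, ENNReal.ofReal_mul (by positivity), bracket, bracket]

theorem bracket_ne_top (p : ℝ) (v : E) : bracket p v ≠ ⊤ := ENNReal.ofReal_ne_top

theorem bracket_mono {p r : ℝ} (h : p ≤ r) (v : E) : bracket p v ≤ bracket r v :=
  ENNReal.ofReal_le_ofReal (Real.rpow_le_rpow_of_exponent_le (by simp) h)

theorem ofReal_norm_rpow_le_bracket {q : ℝ} (hq : 0 ≤ q) (v : E) :
    ENNReal.ofReal (‖v‖ ^ q) ≤ bracket q v :=
  ENNReal.ofReal_le_ofReal (by gcongr; simp)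

theorem bracket_sub_le {β : ℝ} (hβ : 0 ≤ β) (v z : E) :
    bracket β (v - z) ≤ bracket β v * bracket β z := by
  rw [bracket, bracket, bracket, ← ENNReal.ofReal_mul (by positivity),
    ← Real.mul_rpow (by positivity) (by positivity)]
  refine ENNReal.ofReal_le_ofReal (Real.rpow_le_rpow (by positivity) ?_ hβ)
  nlinarith [norm_sub_le v z, mul_nonneg (norm_nonneg v) (norm_nonneg z)]

theorem bracket_le_sub {β : ℝ} (hβ : 0 ≤ β) (v z : E) :
    bracket β z ≤ bracket β v * bracket β (v - z) := by
  simpa using bracket_sub_le hβ v (v - z)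

theorem bracket_neg_mul_le {γ : ℝ} (hγ : 0 ≤ γ) (v z : E) :
    bracket (-γ) (v - z) * bracket (-γ) z ≤
      ENNReal.ofReal (2 ^ γ) * bracket (-γ) v * (bracket (-γ) z + bracket (-γ) (v - z)) := by
  have key : ∀ y : E, ‖v‖ ≤ 1 + 2 * ‖y‖ →
      bracket (-γ) y ≤ ENNReal.ofReal (2 ^ γ) * bracket (-γ) v := fun y hy => by
    rw [bracket, bracket, ← ENNReal.ofReal_mul (by positivity)]
    refine ENNReal.ofReal_le_ofReal ?_
    have : (2 : ℝ) ^ γ = (1 / 2) ^ (-γ) := by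
      rw [one_div, Real.inv_rpow zero_le_two, Real.rpow_neg zero_le_two, inv_inv]
    rw [this, ← Real.mul_rpow (by norm_num) (by positivity)]
    exact Real.rpow_le_rpow_of_nonpos (by positivity) (by linarith) (by linarith)
  have ht : ‖v‖ ≤ ‖v - z‖ + ‖z‖ := by simpa using norm_add_le (v - z) z
  rcases le_total ‖z‖ ‖v - z‖ with h | h
  · calc _ ≤ ENNReal.ofReal (2 ^ γ) * bracket (-γ) v * bracket (-γ) z := by
          gcongr; exact key _ (by linarith)
      _ ≤ _ := by gcongr; exact le_self_add
  · calc _ ≤ bracket (-γ) (v - z) * (ENNReal.ofReal (2 ^ γ) * bracket (-γ) v) := by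
          gcongr; exact key _ (by linarith)
      _ = ENNReal.ofReal (2 ^ γ) * bracket (-γ) v * bracket (-γ) (v - z) := mul_comm _ _
      _ ≤ _ := by gcongr; exact le_add_self

theorem lintegral_bracket_ne_top {p : ℝ} (hp : p < -(Module.finrank ℝ E : ℝ)) :
    ∫⁻ z : E, bracket p z ≠ ⊤ := by
  have := finite_integral_one_add_norm (E := E) (μ := volume) (r := -p) (by linarith)
  rw [neg_neg] at this
  exact this.ne

theorem exists_lintegral_bracket_neg_convolution {γ : ℝ} (hγ : (Module.finrank ℝ E : ℝ) < γ) :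
    ∃ A : ℝ≥0∞, A ≠ ⊤ ∧ ∀ v : E,
      ∫⁻ z, bracket (-γ) (v - z) * bracket (-γ) z ≤ A * bracket (-γ) v := by
  have hI := lintegral_bracket_ne_top (E := E) (p := -γ) (by linarith)
  have hγ0 : 0 ≤ γ := le_trans (Nat.cast_nonneg _) hγ.le
  refine ⟨ENNReal.ofReal (2 ^ γ) * ((∫⁻ z : E, bracket (-γ) z) + ∫⁻ z : E, bracket (-γ) z),
    ENNReal.mul_ne_top ENNReal.ofReal_ne_top (ENNReal.add_ne_top.2 ⟨hI, hI⟩), fun v => ?_⟩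
  refine (lintegral_mono fun z => bracket_neg_mul_le hγ0 v z).trans ?_
  rw [lintegral_const_mul _ (by have := measurable_bracket (E := E) (-γ); fun_prop),
    lintegral_add_left (measurable_bracket _),
    lintegral_sub_left_eq_self (μ := (volume : Measure E)) (fun z => bracket (-γ) z) v]
  exact (mul_right_comm _ _ _).le

theorem lintegral_bracket_convolution_le {γ β : ℝ} (hβ : 0 ≤ β) (v : E) :
    ∫⁻ z, bracket β (v - z) * bracket (-γ) z ≤ (∫⁻ z : E, bracket (β - γ) z) * bracket β v := by
  rw [mul_comm, ← lintegral_const_mul _ (measurable_bracket _)]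
  refine lintegral_mono fun z => ?_
  rw [sub_eq_add_neg β, bracket_add, ← mul_assoc]
  gcongr
  exact bracket_sub_le hβ v z

theorem lintegral_norm_rpow_bracket_convolution_le {γ β : ℝ} (hβ : 0 ≤ β) (hγ : 0 ≤ γ) (v : E) :
    ∫⁻ z, ENNReal.ofReal (‖z‖ ^ (γ + β)) * bracket (-γ) (v - z) * bracket (-γ) z ≤
      (∫⁻ z : E, bracket (β - γ) z) * bracket β v := by
  rw [← lintegral_sub_left_eq_self (μ := (volume : Measure E)) (fun z => bracket (β - γ) z) v,
    mul_comm, ← lintegral_const_mul _ (by have := measurable_bracket (E := E) (β - γ); fun_prop)]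
  refine lintegral_mono fun z => ?_
  calc _ ≤ bracket (γ + β) z * bracket (-γ) (v - z) * bracket (-γ) z := by
        gcongr; exact ofReal_norm_rpow_le_bracket (by positivity) z
    _ = bracket (γ + β + -γ) z * bracket (-γ) (v - z) := by
        rw [bracket_add (γ + β) (-γ), mul_right_comm]
    _ = bracket β z * bracket (-γ) (v - z) := by ring_nf
    _ ≤ bracket β v * bracket β (v - z) * bracket (-γ) (v - z) := by
        gcongr; exact bracket_le_sub hβ v z
    _ = _ := by rw [sub_eq_add_neg β, bracket_add, mul_assoc]

theorem setLIntegral_stableMeasure_le {α c : ℝ} (hα : 0 < α) (hc : 0 ≤ c) (f : E → ℝ≥0∞)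
    (hf : Measurable f) :
    ∫⁻ z in {z : E | 1 ≤ ‖z‖}, f z ∂(stableMeasure E α c) ≤
      ENNReal.ofReal (c * 2 ^ ((Module.finrank ℝ E : ℝ) + α)) *
        ∫⁻ z, f z * bracket (-((Module.finrank ℝ E : ℝ) + α)) z := by
  have hm : MeasurableSet {z : E | 1 ≤ ‖z‖} := measurableSet_le measurable_const measurable_norm
  have hb := measurable_bracket (E := E) (-((Module.finrank ℝ E : ℝ) + α))
  rw [stableMeasure, setLIntegral_withDensity_eq_setLIntegral_mul _ (measurable_stableDensity α c) hf hm,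
    ← lintegral_const_mul _ (by fun_prop)]
  refine (setLIntegral_mono' hm fun z hz => ?_).trans (setLIntegral_le_lintegral _ _)
  have hz : 1 ≤ ‖z‖ := hz
  rw [Pi.mul_apply, mul_comm (f z), ← mul_assoc, bracket, ← ENNReal.ofReal_mul (by positivity)]
  refine mul_le_mul_left (ENNReal.ofReal_le_ofReal ?_) _
  rw [mul_assoc]
  refine mul_le_mul_of_nonneg_left ?_ hc
  have : (2 : ℝ) ^ ((Module.finrank ℝ E : ℝ) + α) = (1 / 2) ^ (-((Module.finrank ℝ E : ℝ) + α)) := by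
    rw [one_div, Real.inv_rpow zero_le_two, Real.rpow_neg zero_le_two, inv_inv]
  rw [this, ← Real.mul_rpow (by norm_num) (by positivity)]
  exact Real.rpow_le_rpow_of_nonpos (by positivity) (by linarith) (neg_nonpos.2 (by positivity))

end Bracket

section Moments

variable {E : Type*} [NormedAddCommGroup E] [InnerProductSpace ℝ E] [FiniteDimensional ℝ E]
  [MeasurableSpace E] [BorelSpace E]

/-- The action of one jump with law `κ` at a uniform time of `(0, 1]` on the density `f` of
`(∫ L, L)`. -/
noncomputable def jumpStep (κ : Measure E) (f : E × E → ℝ≥0∞) (y : E × E) : ℝ≥0∞ :=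
  ∫⁻ s in Set.Ioc (0 : ℝ) 1, ∫⁻ z, f (y.1 - s • z, y.2 - z) ∂κ

theorem lintegral_mul_jumpStep (κ : Measure E) [SFinite κ] {f : E × E → ℝ≥0∞} (hf : Measurable f)
    {G : E → ℝ≥0∞} (hG : Measurable G) (v : E) :
    ∫⁻ x, G x * jumpStep κ f (x, v) =
      ∫⁻ s in Set.Ioc (0 : ℝ) 1, ∫⁻ z, (∫⁻ x, G (x + s • z) * f (x, v - z)) ∂κ := by
  have h1 : ∀ x, G x * jumpStep κ f (x, v) =
      ∫⁻ s in Set.Ioc (0 : ℝ) 1, ∫⁻ z, G x * f (x - s • z, v - z) ∂κ := fun x => by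
    rw [jumpStep, ← lintegral_const_mul _ (by fun_prop)]
    refine lintegral_congr fun s => ?_
    rw [lintegral_const_mul _ (by fun_prop)]
  simp_rw [h1]
  rw [lintegral_lintegral_swap (by fun_prop)]
  refine lintegral_congr fun s => ?_
  rw [lintegral_lintegral_swap (by fun_prop)]
  refine lintegral_congr fun z => ?_
  rw [← lintegral_add_right_eq_self (μ := (volume : Measure E)) _ (s • z)]
  simp

theorem lintegral_jumpStep (κ : Measure E) [SFinite κ] {f : E × E → ℝ≥0∞} (hf : Measurable f)
    (v : E) : ∫⁻ x, jumpStep κ f (x, v) = ∫⁻ z, (∫⁻ x, f (x, v - z)) ∂κ := by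
  simpa using lintegral_mul_jumpStep κ hf (G := fun _ => 1) measurable_const v

theorem ofReal_norm_add_smul_rpow_le {q : ℝ} (hq : 0 ≤ q) {s : ℝ} (hs : s ∈ Set.Ioc (0 : ℝ) 1)
    (x z : E) : ENNReal.ofReal (‖x + s • z‖ ^ q) ≤
      ENNReal.ofReal (2 ^ q) * (ENNReal.ofReal (‖x‖ ^ q) + ENNReal.ofReal (‖z‖ ^ q)) := by
  rw [← ENNReal.ofReal_add (by positivity) (by positivity), ← ENNReal.ofReal_mul (by positivity)]
  refine ENNReal.ofReal_le_ofReal ?_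
  have h1 : ‖x + s • z‖ ≤ ‖x‖ + ‖z‖ := by
    refine (norm_add_le _ _).trans ?_
    rw [norm_smul, Real.norm_of_nonneg hs.1.le]
    nlinarith [hs.2, norm_nonneg z]
  rcases le_total ‖x‖ ‖z‖ with h | h
  · calc ‖x + s • z‖ ^ q ≤ (2 * ‖z‖) ^ q := by gcongr; linarith
      _ = 2 ^ q * ‖z‖ ^ q := Real.mul_rpow (by norm_num) (norm_nonneg _)
      _ ≤ _ := by gcongr; linarith [Real.rpow_nonneg (norm_nonneg x) q]
  · calc ‖x + s • z‖ ^ q ≤ (2 * ‖x‖) ^ q := by gcongr; linarith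
      _ = 2 ^ q * ‖x‖ ^ q := Real.mul_rpow (by norm_num) (norm_nonneg _)
      _ ≤ _ := by gcongr; linarith [Real.rpow_nonneg (norm_nonneg z) q]

theorem lintegral_norm_rpow_mul_jumpStep_le (κ : Measure E) [SFinite κ] {f : E × E → ℝ≥0∞}
    (hf : Measurable f) {q : ℝ} (hq : 0 ≤ q) (v : E) :
    ∫⁻ x, ENNReal.ofReal (‖x‖ ^ q) * jumpStep κ f (x, v) ≤ ENNReal.ofReal (2 ^ q) *
      (∫⁻ z, (∫⁻ x, ENNReal.ofReal (‖x‖ ^ q) * f (x, v - z)) ∂κ +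
        ∫⁻ z, ENNReal.ofReal (‖z‖ ^ q) * (∫⁻ x, f (x, v - z)) ∂κ) := by
  rw [lintegral_mul_jumpStep κ hf (by fun_prop)]
  calc _ ≤ ∫⁻ s in Set.Ioc (0 : ℝ) 1, ENNReal.ofReal (2 ^ q) *
      (∫⁻ z, (∫⁻ x, ENNReal.ofReal (‖x‖ ^ q) * f (x, v - z)) ∂κ +
        ∫⁻ z, ENNReal.ofReal (‖z‖ ^ q) * (∫⁻ x, f (x, v - z)) ∂κ) := by
        refine setLIntegral_mono' measurableSet_Ioc fun s hs => ?_
        have hmz : Measurable fun z => ∫⁻ x, ENNReal.ofReal (‖x‖ ^ q) * f (x, v - z) :=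
          Measurable.lintegral_prod_right' (f := fun a : E × E =>
            ENNReal.ofReal (‖a.2‖ ^ q) * f (a.2, v - a.1)) (by fun_prop)
        rw [← lintegral_add_left hmz, ← lintegral_const_mul' _ _ ENNReal.ofReal_ne_top]
        refine lintegral_mono fun z => ?_
        rw [← lintegral_const_mul _ (by fun_prop), ← lintegral_add_left (by fun_prop),
          ← lintegral_const_mul' _ _ ENNReal.ofReal_ne_top]
        refine lintegral_mono fun x => ?_
        rw [← add_mul, ← mul_assoc]
        gcongr
        exact ofReal_norm_add_smul_rpow_le hq hs x z
    _ = _ := by simp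

theorem exists_moment_le_bracket [Nontrivial E] {α c β : ℝ} (hα : 0 < α) (hc : 0 ≤ c)
    (hβ : 0 ≤ β) (hβα : β < α) {p : ℕ → E × E → ℝ≥0∞} (hp : ∀ n, Measurable (p n))
    (hrec : ∀ n, p (n + 1) = jumpStep ((stableMeasure E α c).restrict {z : E | 1 ≤ ‖z‖}) (p n))
    [SFinite ((stableMeasure E α c).restrict {z : E | 1 ≤ ‖z‖})]
    (h0 : ∀ N : ℕ, ∃ C : ℝ, 0 ≤ C ∧ ∀ x v,
      p 0 (x, v) ≤ ENNReal.ofReal (C * ((1 + ‖x‖) ^ N * (1 + ‖v‖) ^ N)⁻¹)) :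
    ∃ C : ℝ≥0∞, C ≠ ⊤ ∧ ∃ A : ℝ≥0∞, A ≠ ⊤ ∧ ∀ n v,
      ∫⁻ x, p n (x, v) ≤ C * A ^ n * bracket (-((Module.finrank ℝ E : ℝ) + α)) v ∧
      ∫⁻ x, ENNReal.ofReal (‖x‖ ^ ((Module.finrank ℝ E : ℝ) + α + β)) * p n (x, v) ≤
        C * A ^ n * bracket β v := by
  set γ : ℝ := (Module.finrank ℝ E : ℝ) + α with hγ
  set κ := (stableMeasure E α c).restrict {z : E | 1 ≤ ‖z‖} with hκ
  have hγ0 : 0 ≤ γ := by positivity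
  have mb := fun p : ℝ => measurable_bracket (E := E) p
  have mbs : ∀ (p : ℝ) (v : E), Measurable fun z : E => bracket p (v - z) := fun p v =>
    (mb p).comp (measurable_const.sub measurable_id)
  obtain ⟨A₁, hA₁, h₁⟩ := exists_lintegral_bracket_neg_convolution (E := E) (γ := γ) (by linarith)
  have hA₂ : ∫⁻ z : E, bracket (β - γ) z ≠ ⊤ := lintegral_bracket_ne_top (by linarith)
  set A₂ := ∫⁻ z : E, bracket (β - γ) z with hA₂def
  set D := ENNReal.ofReal (c * 2 ^ γ) with hD
  have hstep : ∀ f : E → ℝ≥0∞, Measurable f → ∫⁻ z, f z ∂κ ≤ D * ∫⁻ z, f z * bracket (-γ) z :=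
    setLIntegral_stableMeasure_le hα hc
  have c₁ : ∀ v : E, ∫⁻ z, bracket (-γ) (v - z) ∂κ ≤ D * A₁ * bracket (-γ) v := fun v => by
    refine (hstep _ (mbs _ v)).trans ?_
    rw [mul_assoc]; gcongr; exact h₁ v
  have c₂ : ∀ v : E, ∫⁻ z, bracket β (v - z) ∂κ ≤ D * A₂ * bracket β v := fun v => by
    refine (hstep _ (mbs _ v)).trans ?_
    rw [mul_assoc]; gcongr; exact lintegral_bracket_convolution_le hβ v
  have c₃ : ∀ v : E, ∫⁻ z, ENNReal.ofReal (‖z‖ ^ (γ + β)) * bracket (-γ) (v - z) ∂κ ≤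
      D * A₂ * bracket β v := fun v => by
    refine (hstep _ (Measurable.mul (by fun_prop)
      (mbs _ v))).trans ?_
    rw [mul_assoc]; gcongr; exact lintegral_norm_rpow_bracket_convolution_le hβ hγ0 v
  obtain ⟨N, hN⟩ := exists_nat_gt (2 * γ + β)
  obtain ⟨K, hK0, hK⟩ := h0 N
  have hK' : ∀ x v : E, p 0 (x, v) ≤ ENNReal.ofReal K * (bracket (-(N : ℝ)) x * bracket (-γ) v) :=
      fun x v => by
    refine (hK x v).trans ?_
    rw [ENNReal.ofReal_mul hK0, mul_inv, ENNReal.ofReal_mul (by positivity)]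
    gcongr
    · rw [bracket, Real.rpow_neg (by positivity), Real.rpow_natCast]
    · refine le_trans (le_of_eq ?_) (bracket_mono (p := -(N : ℝ)) (by linarith) v)
      rw [bracket, Real.rpow_neg (by positivity), Real.rpow_natCast]
  have hB : ∫⁻ x : E, bracket (γ + β - N) x ≠ ⊤ := lintegral_bracket_ne_top (by linarith)
  set B := ∫⁻ x : E, bracket (γ + β - N) x with hBdef
  refine ⟨ENNReal.ofReal K * B, ENNReal.mul_ne_top ENNReal.ofReal_ne_top hB,
    D * A₁ + ENNReal.ofReal (2 ^ (γ + β)) * (D * A₂ + D * A₂), ?_, fun n => ?_⟩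
  · refine ENNReal.add_ne_top.2 ⟨ENNReal.mul_ne_top ENNReal.ofReal_ne_top hA₁, ?_⟩
    have := ENNReal.mul_ne_top (a := D) ENNReal.ofReal_ne_top hA₂
    exact ENNReal.mul_ne_top ENNReal.ofReal_ne_top (ENNReal.add_ne_top.2 ⟨this, this⟩)
  set A := D * A₁ + ENNReal.ofReal (2 ^ (γ + β)) * (D * A₂ + D * A₂) with hA
  set C := ENNReal.ofReal K * B with hC
  induction n with
  | zero =>
    intro v
    simp only [pow_zero, mul_one]
    constructor
    · refine (lintegral_mono fun x => hK' x v).trans ?_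
      rw [lintegral_const_mul _ (by have := mb (-(N : ℝ)); fun_prop),
        lintegral_mul_const _ (mb _), hC, ← mul_assoc]
      gcongr
      exact lintegral_mono fun x => bracket_mono (by linarith) x
    · calc _ ≤ ∫⁻ x : E, ENNReal.ofReal K * (bracket (γ + β - N) x * bracket (-γ) v) := by
            refine lintegral_mono fun x => ?_
            calc _ ≤ bracket (γ + β) x *
                  (ENNReal.ofReal K * (bracket (-(N : ℝ)) x * bracket (-γ) v)) :=
                  mul_le_mul' (ofReal_norm_rpow_le_bracket (by positivity) x) (hK' x v)
              _ = _ := by rw [sub_eq_add_neg (γ + β), bracket_add (γ + β) (-(N : ℝ))]; ring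
        _ = C * bracket (-γ) v := by
            rw [lintegral_const_mul _ (by have := mb (γ + β - N); fun_prop),
              lintegral_mul_const _ (mb _), hC, ← mul_assoc]
        _ ≤ _ := by gcongr; exact bracket_mono (by linarith) v
  | succ n ih =>
    intro v
    rw [hrec n]
    constructor
    · rw [lintegral_jumpStep κ (hp n)]
      calc _ ≤ ∫⁻ z, C * A ^ n * bracket (-γ) (v - z) ∂κ := lintegral_mono fun z => (ih (v - z)).1
        _ = C * A ^ n * ∫⁻ z, bracket (-γ) (v - z) ∂κ :=
            lintegral_const_mul _ (mbs _ v)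
        _ ≤ C * A ^ n * (A * bracket (-γ) v) := by
            gcongr
            refine (c₁ v).trans ?_
            gcongr
            exact le_self_add
        _ = _ := by ring
    · calc _ ≤ _ := lintegral_norm_rpow_mul_jumpStep_le κ (hp n) (by positivity) v
        _ ≤ ENNReal.ofReal (2 ^ (γ + β)) * (∫⁻ z, C * A ^ n * bracket β (v - z) ∂κ +
            ∫⁻ z, C * A ^ n * (ENNReal.ofReal (‖z‖ ^ (γ + β)) * bracket (-γ) (v - z)) ∂κ) := by
            refine mul_le_mul_right (add_le_add (lintegral_mono fun z => (ih (v - z)).2)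
              (lintegral_mono fun z => ?_)) _
            rw [mul_left_comm]
            exact mul_le_mul_right (ih (v - z)).1 _
        _ ≤ ENNReal.ofReal (2 ^ (γ + β)) * (C * A ^ n * (D * A₂ * bracket β v) +
            C * A ^ n * (D * A₂ * bracket β v)) := by
            rw [lintegral_const_mul _ (mbs _ v),
              lintegral_const_mul _ (by have := mbs (-γ) v; fun_prop)]
            gcongr
            · exact c₂ v
            · exact c₃ v
        _ = C * A ^ n * (ENNReal.ofReal (2 ^ (γ + β)) * (D * A₂ + D * A₂)) * bracket β v := by ring
        _ ≤ C * A ^ n * A * bracket β v := by gcongr; exact le_add_self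
        _ = _ := by ring

end Moments

section MomentSum

variable {E : Type*} [NormedAddCommGroup E] [InnerProductSpace ℝ E] [FiniteDimensional ℝ E]
  [MeasurableSpace E] [BorelSpace E]

theorem tsum_ofReal_inv_factorial_mul_pow_ne_top {A : ℝ≥0∞} (hA : A ≠ ⊤) :
    ∑' n : ℕ, ENNReal.ofReal (n.factorial : ℝ)⁻¹ * A ^ n ≠ ⊤ := by
  lift A to NNReal using hA
  have h : ∀ n : ℕ, ENNReal.ofReal (n.factorial : ℝ)⁻¹ * (A : ℝ≥0∞) ^ n =
      ENNReal.ofReal ((A : ℝ) ^ n / n.factorial) := fun n => by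
    rw [div_eq_inv_mul, ENNReal.ofReal_mul (by positivity), ENNReal.ofReal_pow A.coe_nonneg,
      ENNReal.ofReal_coe_nnreal]
  simp_rw [h]
  rw [← ENNReal.ofReal_tsum_of_nonneg (fun n => by positivity) (Real.summable_pow_div_factorial _)]
  exact ENNReal.ofReal_ne_top

theorem lintegral_mul_expansion_le {p : ℕ → E × E → ℝ≥0∞} (hp : ∀ n, Measurable (p n))
    {P : E × E → ℝ≥0∞} {Λ : ℝ≥0∞}
    (hP : ∀ y, P y = Λ * ∑' n : ℕ, ENNReal.ofReal (n.factorial : ℝ)⁻¹ * p n y)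
    {G : E → ℝ≥0∞} (hG : Measurable G) {v : E} {A C b : ℝ≥0∞}
    (h : ∀ n, ∫⁻ x, G x * p n (x, v) ≤ C * A ^ n * b) :
    ∫⁻ x, G x * P (x, v) ≤
      Λ * (C * ∑' n : ℕ, ENNReal.ofReal (n.factorial : ℝ)⁻¹ * A ^ n) * b := by
  have e : ∀ x, G x * P (x, v) =
      Λ * ∑' n : ℕ, ENNReal.ofReal (n.factorial : ℝ)⁻¹ * (G x * p n (x, v)) := fun x => by
    rw [hP, mul_left_comm, ← ENNReal.tsum_mul_left]
    simp_rw [mul_left_comm (G x)]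
  simp_rw [e]
  rw [lintegral_const_mul _ (Measurable.tsum fun n => by have := hp n; fun_prop),
    lintegral_tsum fun n => by have := hp n; fun_prop, mul_assoc Λ]
  gcongr
  rw [← ENNReal.tsum_mul_left, ← ENNReal.tsum_mul_right]
  refine ENNReal.tsum_le_tsum fun n => ?_
  rw [lintegral_const_mul _ (by have := hp n; fun_prop)]
  calc _ ≤ ENNReal.ofReal (n.factorial : ℝ)⁻¹ * (C * A ^ n * b) := by gcongr; exact h n
    _ = _ := by ring

theorem ofReal_norm_rpow_le_add {q r : ℝ} (hq : 0 ≤ q) (hqr : q ≤ r) (x v : E) :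
    ENNReal.ofReal (‖x‖ ^ q) ≤ bracket q v + ENNReal.ofReal (‖x‖ ^ r) * bracket (q - r) v := by
  rcases le_or_gt ‖x‖ (1 + ‖v‖) with h | h
  · exact le_add_right (ENNReal.ofReal_le_ofReal (Real.rpow_le_rpow (norm_nonneg _) h hq))
  · refine le_add_left ?_
    have hv : 0 < 1 + ‖v‖ := by positivity
    rw [bracket, ← ENNReal.ofReal_mul (by positivity)]
    refine ENNReal.ofReal_le_ofReal ?_
    calc ‖x‖ ^ q = ‖x‖ ^ r * ‖x‖ ^ (q - r) := by
          rw [← Real.rpow_add (hv.trans h)]; congr 1; ring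
      _ ≤ _ := mul_le_mul_of_nonneg_left
        (Real.rpow_le_rpow_of_nonpos hv h.le (by linarith)) (by positivity)

theorem exists_expansion_moment_le [Nontrivial E] {α c q : ℝ} (hα : 0 < α) (hc : 0 ≤ c)
    (hq0 : 0 ≤ q) (hq : q < (Module.finrank ℝ E : ℝ) + 2 * α)
    {p : ℕ → E × E → ℝ≥0∞} (hp : ∀ n, Measurable (p n))
    (hrec : ∀ n, p (n + 1) = jumpStep ((stableMeasure E α c).restrict {z : E | 1 ≤ ‖z‖}) (p n))
    [SFinite ((stableMeasure E α c).restrict {z : E | 1 ≤ ‖z‖})]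
    (h0 : ∀ N : ℕ, ∃ C : ℝ, 0 ≤ C ∧ ∀ x v,
      p 0 (x, v) ≤ ENNReal.ofReal (C * ((1 + ‖x‖) ^ N * (1 + ‖v‖) ^ N)⁻¹))
    {P : E × E → ℝ≥0∞} {Λ : ℝ≥0∞} (hΛ : Λ ≠ ⊤)
    (hP : ∀ y, P y = Λ * ∑' n : ℕ, ENNReal.ofReal (n.factorial : ℝ)⁻¹ * p n y) :
    ∃ C : ℝ≥0∞, C ≠ ⊤ ∧ ∀ v, ∫⁻ x, ENNReal.ofReal (‖x‖ ^ q) * P (x, v) ≤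
      C * bracket (q - (Module.finrank ℝ E : ℝ) - α) v := by
  set γ : ℝ := (Module.finrank ℝ E : ℝ) + α with hγ
  set β := max (q - γ) (α / 2) with hβ
  have hβ0 : 0 ≤ β := le_max_of_le_right (by positivity)
  have hβα : β < α := max_lt (by linarith) (by linarith)
  have hqβ : q ≤ γ + β := by linarith [le_max_left (q - γ) (α / 2)]
  obtain ⟨C, hC, A, hA, h⟩ := exists_moment_le_bracket hα hc hβ0 hβα hp hrec h0
  have hPm : Measurable P := by
    have : P = fun y => Λ * ∑' n : ℕ, ENNReal.ofReal (n.factorial : ℝ)⁻¹ * p n y := funext hP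
    rw [this]
    exact (Measurable.tsum fun n => by have := hp n; fun_prop).const_mul _
  set D := Λ * (C * ∑' n : ℕ, ENNReal.ofReal (n.factorial : ℝ)⁻¹ * A ^ n) with hD
  have hDt : D ≠ ⊤ := ENNReal.mul_ne_top hΛ
    (ENNReal.mul_ne_top hC (tsum_ofReal_inv_factorial_mul_pow_ne_top hA))
  refine ⟨D + D, ENNReal.add_ne_top.2 ⟨hDt, hDt⟩, fun v => ?_⟩
  have h₁ : ∫⁻ x, P (x, v) ≤ D * bracket (-γ) v := by
    have := lintegral_mul_expansion_le hp hP (G := fun _ => 1) measurable_const (v := v)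
      (A := A) (C := C) (b := bracket (-γ) v) (fun n => by simpa only [one_mul] using (h n v).1)
    simpa using this
  have h₂ := lintegral_mul_expansion_le hp hP (G := fun x => ENNReal.ofReal (‖x‖ ^ (γ + β)))
    (by fun_prop) (v := v) (fun n => (h n v).2)
  calc _ ≤ ∫⁻ x, (bracket q v * P (x, v) +
        bracket (q - (γ + β)) v * (ENNReal.ofReal (‖x‖ ^ (γ + β)) * P (x, v))) := by
        refine lintegral_mono fun x => ?_
        rw [← mul_assoc, ← add_mul, mul_comm (bracket (q - (γ + β)) v)]
        gcongr
        exact ofReal_norm_rpow_le_add hq0 hqβ x v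
    _ = bracket q v * (∫⁻ x, P (x, v)) + bracket (q - (γ + β)) v *
        ∫⁻ x, ENNReal.ofReal (‖x‖ ^ (γ + β)) * P (x, v) := by
        rw [lintegral_add_left (by fun_prop), lintegral_const_mul _ (by fun_prop),
          lintegral_const_mul _ (by fun_prop)]
    _ ≤ bracket q v * (D * bracket (-γ) v) + bracket (q - (γ + β)) v * (D * bracket β v) := by
        gcongr
    _ = D * (bracket q v * bracket (-γ) v) + D * (bracket (q - (γ + β)) v * bracket β v) := by ring
    _ = _ := by
        rw [← bracket_add, ← bracket_add, add_mul, hγ]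
        congr 3 <;> ring

end MomentSum

section MassLower

variable {E : Type*} [NormedAddCommGroup E] [InnerProductSpace ℝ E] [FiniteDimensional ℝ E]
  [MeasurableSpace E] [BorelSpace E]

theorem le_setLIntegral_stableMeasure {α c R : ℝ} (hα : 0 < α) (hc : 0 ≤ c) {A : Set E}
    (hA : MeasurableSet A) (hA1 : ∀ z ∈ A, 1 ≤ ‖z‖) (hAR : ∀ z ∈ A, ‖z‖ ≤ R) {f : E → ℝ≥0∞}
    {a : ℝ≥0∞} (hf : ∀ z ∈ A, a ≤ f z) :
    a * (ENNReal.ofReal (c * R ^ (-((Module.finrank ℝ E : ℝ) + α))) * volume A) ≤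
      ∫⁻ z in {z : E | 1 ≤ ‖z‖}, f z ∂(stableMeasure E α c) := by
  calc _ ≤ a * stableMeasure E α c A := by
        gcongr
        rw [stableMeasure, withDensity_apply _ hA, ← setLIntegral_const]
        refine setLIntegral_mono' hA fun z hz => ENNReal.ofReal_le_ofReal ?_
        refine mul_le_mul_of_nonneg_left ?_ hc
        exact Real.rpow_le_rpow_of_nonpos (by linarith [hA1 z hz]) (hAR z hz)
          (neg_nonpos.2 (by positivity))
    _ = ∫⁻ _ in A, a ∂(stableMeasure E α c) := (setLIntegral_const _ _).symm
    _ ≤ ∫⁻ z in A, f z ∂(stableMeasure E α c) := setLIntegral_mono' hA hf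
    _ ≤ _ := lintegral_mono_set hA1

theorem exists_norm_eq_and_le_norm_sub [Nontrivial E] {a : ℝ} (ha : 0 ≤ a) (v : E) :
    ∃ z : E, ‖z‖ = a ∧ a ≤ ‖v - z‖ := by
  obtain ⟨e, he⟩ := exists_norm_eq E ha
  by_contra! h
  have h1 := h e he
  have h2 := h (-e) (by rwa [norm_neg])
  have h3 : ‖(2 : ℝ) • e‖ ≤ ‖v - -e‖ + ‖v - e‖ := by
    refine le_trans (le_of_eq ?_) (norm_sub_le _ _)
    congr 1
    rw [two_smul]; abel
  rw [norm_smul, he, Real.norm_ofNat] at h3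
  linarith

theorem exists_bracket_le_mass [Nontrivial E] {α c : ℝ} (hα : 0 < α) (hc : 0 < c)
    {p : ℕ → E × E → ℝ≥0∞} (hp : ∀ n, Measurable (p n))
    (hrec : ∀ n, p (n + 1) = jumpStep ((stableMeasure E α c).restrict {z : E | 1 ≤ ‖z‖}) (p n))
    [SFinite ((stableMeasure E α c).restrict {z : E | 1 ≤ ‖z‖})]
    (h0 : ∃ r > 0, ∃ ε > 0, ∀ x v, ‖x‖ < r → ‖v‖ < r → ENNReal.ofReal ε ≤ p 0 (x, v))
    {P : E × E → ℝ≥0∞} {Λ : ℝ≥0∞} (hΛ : Λ ≠ 0)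
    (hP : ∀ y, P y = Λ * ∑' n : ℕ, ENNReal.ofReal (n.factorial : ℝ)⁻¹ * p n y) :
    ∃ a : ℝ≥0∞, a ≠ 0 ∧ ∀ v, a * bracket (-((Module.finrank ℝ E : ℝ) + α)) v ≤
      ∫⁻ x, P (x, v) := by
  obtain ⟨r, hr, ε, hε, h⟩ := h0
  set γ : ℝ := (Module.finrank ℝ E : ℝ) + α with hγ
  have hγ0 : 0 ≤ γ := by positivity
  set ρ := min r 1 with hρ
  have hρ0 : 0 < ρ := lt_min hr one_pos
  set V := volume (Metric.ball (0 : E) ρ) with hV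
  have hV0 : V ≠ 0 := (Metric.measure_ball_pos _ _ hρ0).ne'
  have m0 : ∀ v : E, ‖v‖ < ρ → ENNReal.ofReal ε * V ≤ ∫⁻ x, p 0 (x, v) := fun v hv => by
    rw [hV, ← setLIntegral_const]
    refine (setLIntegral_mono' measurableSet_ball fun x hx => ?_).trans
      (setLIntegral_le_lintegral _ _)
    rw [mem_ball_zero_iff] at hx
    exact h x v (hx.trans_le (min_le_left _ _)) (hv.trans_le (min_le_left _ _))
  have m1 : ∀ v : E, 2 ≤ ‖v‖ → ENNReal.ofReal ε * V * (ENNReal.ofReal c * bracket (-γ) v * V) ≤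
      ∫⁻ x, p 1 (x, v) := fun v hv => by
    rw [hrec 0, lintegral_jumpStep _ (hp 0), bracket, ← ENNReal.ofReal_mul hc.le,
      show V = volume (Metric.ball v ρ) from (Measure.addHaar_ball_center _ v ρ).symm]
    have hball : ∀ z ∈ Metric.ball v ρ, ‖v - z‖ < ρ := fun z hz => by
      rwa [mem_ball_iff_norm, norm_sub_rev] at hz
    refine le_setLIntegral_stableMeasure hα hc.le measurableSet_ball (fun z hz => ?_)
      (fun z hz => ?_) (fun z hz => ?_)
    · linarith [hball z hz, min_le_right r 1, norm_sub_norm_le v z]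
    · linarith [hball z hz, min_le_right r 1, norm_sub_rev v z, norm_sub_norm_le z v]
    · rw [Measure.addHaar_ball_center]
      exact m0 _ (hball z hz)
  set a₁ := ENNReal.ofReal ε * V * (ENNReal.ofReal c * V) with ha₁
  set B := volume (Metric.ball (0 : E) 1) with hB
  have m2 : ∀ v : E, a₁ * (ENNReal.ofReal (6 ^ (-γ)) * bracket (-γ) v) *
      (ENNReal.ofReal (c * 5 ^ (-γ)) * B) ≤ ∫⁻ x, p 2 (x, v) := fun v => by
    obtain ⟨z₀, hz₀, hvz₀⟩ := exists_norm_eq_and_le_norm_sub (a := 4) (by norm_num) v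
    rw [hrec 1, lintegral_jumpStep _ (hp 1), hB, ← Measure.addHaar_ball_center _ z₀]
    have hball : ∀ z ∈ Metric.ball z₀ 1, ‖z - z₀‖ < 1 := fun z hz => by
      rwa [mem_ball_iff_norm] at hz
    refine le_setLIntegral_stableMeasure hα hc.le measurableSet_ball (fun z hz => ?_)
      (fun z hz => ?_) (fun z hz => ?_)
    · linarith [hball z hz, norm_sub_rev z z₀, norm_sub_norm_le z₀ z]
    · linarith [hball z hz, norm_sub_norm_le z z₀]
    · have h1 : ‖v - z₀‖ ≤ ‖v - z‖ + ‖z - z₀‖ := norm_sub_le_norm_sub_add_norm_sub v z z₀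
      have h2 : ‖z‖ ≤ 5 := by linarith [hball z hz, norm_sub_norm_le z z₀]
      refine le_trans ?_ (m1 (v - z) (by linarith [hball z hz]))
      rw [ha₁, mul_right_comm (ENNReal.ofReal c), ← mul_assoc _ _ (bracket (-γ) (v - z))]
      gcongr
      rw [bracket, bracket, ← ENNReal.ofReal_mul (by positivity),
        ← Real.mul_rpow (by norm_num) (by positivity)]
      refine ENNReal.ofReal_le_ofReal (Real.rpow_le_rpow_of_nonpos (by positivity) ?_ (by linarith))
      linarith [norm_sub_le v z, norm_nonneg v]
  refine ⟨Λ * (ENNReal.ofReal (Nat.factorial 2 : ℝ)⁻¹ * (a₁ * ENNReal.ofReal (6 ^ (-γ)) *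
    (ENNReal.ofReal (c * 5 ^ (-γ)) * B))), ?_, fun v => ?_⟩
  · have hB0 : B ≠ 0 := (Metric.measure_ball_pos _ _ one_pos).ne'
    have ho : ∀ {t : ℝ}, 0 < t → ENNReal.ofReal t ≠ 0 := fun ht => (ENNReal.ofReal_pos.2 ht).ne'
    refine mul_ne_zero hΛ (mul_ne_zero (ho (by positivity)) (mul_ne_zero (mul_ne_zero (mul_ne_zero
      (mul_ne_zero (ho hε) hV0) (mul_ne_zero (ho hc) hV0)) (ho (by positivity)))
      (mul_ne_zero (ho (by positivity)) hB0)))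
  · calc _ = Λ * (ENNReal.ofReal (Nat.factorial 2 : ℝ)⁻¹ *
          (a₁ * (ENNReal.ofReal (6 ^ (-γ)) * bracket (-γ) v) *
            (ENNReal.ofReal (c * 5 ^ (-γ)) * B))) := by ring
      _ ≤ Λ * (ENNReal.ofReal (Nat.factorial 2 : ℝ)⁻¹ * ∫⁻ x, p 2 (x, v)) := by
          gcongr; exact m2 v
      _ = ∫⁻ x, Λ * (ENNReal.ofReal (Nat.factorial 2 : ℝ)⁻¹ * p 2 (x, v)) := by
          have := hp 2
          rw [lintegral_const_mul _ (by fun_prop), lintegral_const_mul _ (by fun_prop)]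
      _ ≤ _ := by
          refine lintegral_mono fun x => ?_
          rw [hP]
          gcongr
          exact ENNReal.le_tsum (f := fun n => ENNReal.ofReal (n.factorial : ℝ)⁻¹ * p n (x, v)) 2

end MassLower

section MomentLower

variable {E : Type*} [NormedAddCommGroup E] [InnerProductSpace ℝ E] [FiniteDimensional ℝ E]
  [MeasurableSpace E] [BorelSpace E]

theorem kineticChar_reflect (α : ℝ) (w : E × E) :
    kineticChar α (-w.1, w.2 + w.1) = kineticChar α w := by
  have h : ∀ s : ℝ, s • -w.1 + (w.2 + w.1) = (1 - s) • w.1 + w.2 := fun s => by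
    rw [sub_smul, one_smul, smul_neg]; abel
  simp only [kineticChar, h]
  rw [intervalIntegral.integral_comp_sub_left (fun s => ‖s • w.1 + w.2‖ ^ α)]
  simp

theorem cosTransform_kineticChar_reflect (α : ℝ) (x v : E) :
    cosTransform (kineticChar α) (v - x, v) = cosTransform (kineticChar α) (x, v) := by
  have hmeas : Measurable fun w : E × E => (-w.1, w.2 + w.1) := by fun_prop
  have hinv : Function.Involutive fun w : E × E => (-w.1, w.2 + w.1) := fun w => by simp
  have hT : MeasurePreserving (MeasurableEquiv.ofInvolutive _ hinv hmeas)
      (volume : Measure (E × E)) volume :=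
    (Measure.measurePreserving_swap (μ := (volume : Measure E)) (ν := volume)).comp
      (measurePreserving_add_prod_neg (volume : Measure E) volume)
  rw [cosTransform, ← hT.integral_comp']
  refine integral_congr_ae (Eventually.of_forall fun w => ?_)
  change Real.cos (⟪v - x, -w.1⟫ + ⟪v, w.2 + w.1⟫) * kineticChar α (-w.1, w.2 + w.1) = _
  rw [kineticChar_reflect]
  congr 2
  rw [inner_sub_left, inner_neg_right, inner_neg_right, inner_add_right]
  ring

theorem bracket_le_lintegral_norm_rpow_mul_of_one_le {P : E × E → ℝ≥0∞} (hPm : Measurable P)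
    (hsymm : ∀ x v, P (v - x, v) = P (x, v)) {q : ℝ} (hq : 0 ≤ q) {v : E} (hv : 1 ≤ ‖v‖) :
    ENNReal.ofReal (4 ^ (-q)) * bracket q v * ∫⁻ x, P (x, v) ≤
      2 * ∫⁻ x, ENNReal.ofReal (‖x‖ ^ q) * P (x, v) := by
  have h : ∫⁻ x, ENNReal.ofReal (‖v - x‖ ^ q) * P (x, v) =
      ∫⁻ x, ENNReal.ofReal (‖x‖ ^ q) * P (x, v) := by
    rw [← lintegral_sub_left_eq_self (μ := (volume : Measure E)) _ v]
    simp [hsymm]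
  rw [two_mul]
  nth_rw 1 [← h]
  rw [← lintegral_add_left (by fun_prop), ← lintegral_const_mul _ (by fun_prop)]
  refine lintegral_mono fun x => ?_
  rw [← add_mul]
  gcongr
  have h4 : ENNReal.ofReal (4 ^ (-q)) * bracket q v = ENNReal.ofReal (((1 + ‖v‖) / 4) ^ q) := by
    rw [bracket, ← ENNReal.ofReal_mul (by positivity), Real.div_rpow (by positivity) (by norm_num),
      Real.rpow_neg (by norm_num), div_eq_inv_mul]
  rw [h4]
  have ht : ‖v‖ ≤ ‖v - x‖ + ‖x‖ := by simpa using norm_add_le (v - x) x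
  rcases le_total ‖x‖ ‖v - x‖ with hx | hx
  · exact le_add_right (ENNReal.ofReal_le_ofReal
      (Real.rpow_le_rpow (by positivity) (by linarith) hq))
  · exact le_add_left (ENNReal.ofReal_le_ofReal
      (Real.rpow_le_rpow (by positivity) (by linarith) hq))

theorem exists_lt_lintegral_norm_rpow_mul [Nontrivial E] {P : E × E → ℝ≥0∞}
    {S : ℝ≥0∞} (hS : S ≠ ⊤) (hPS : ∀ y, P y ≤ S) {q : ℝ} (hq : 0 ≤ q)
    {b : ℝ≥0∞} (hb : b ≠ 0) (hbt : b ≠ ⊤) :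
    ∃ δ > 0, ∀ v, b ≤ ∫⁻ x, P (x, v) →
      ENNReal.ofReal (δ ^ q) * (b / 2) ≤ ∫⁻ x, ENNReal.ofReal (‖x‖ ^ q) * P (x, v) := by
  have hV : volume (Metric.ball (0 : E) 1) ≠ ⊤ := measure_ball_lt_top.ne
  have hlim : Tendsto (fun δ : ℝ => S * (ENNReal.ofReal (δ ^ Module.finrank ℝ E) *
      volume (Metric.ball (0 : E) 1))) (𝓝[>] 0) (𝓝 0) := by
    have h1 : Tendsto (fun δ : ℝ => ENNReal.ofReal (δ ^ Module.finrank ℝ E)) (𝓝[>] 0) (𝓝 0) := by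
      have h2 : Tendsto (fun δ : ℝ => ENNReal.ofReal (δ ^ Module.finrank ℝ E)) (𝓝 0)
          (𝓝 (ENNReal.ofReal (0 ^ Module.finrank ℝ E))) :=
        (ENNReal.continuous_ofReal.comp (continuous_pow _)).tendsto 0
      rw [zero_pow Module.finrank_pos.ne', ENNReal.ofReal_zero] at h2
      exact h2.mono_left nhdsWithin_le_nhds
    have h3 := ENNReal.Tendsto.const_mul (ENNReal.Tendsto.mul_const h1 (Or.inr hV)) (a := S)
      (Or.inr hS)
    simpa using h3
  have hb2 : 0 < b / 2 := ENNReal.half_pos hb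
  obtain ⟨δ, hδ, hδ0⟩ := ((hlim.eventually (gt_mem_nhds hb2)).and
    (eventually_mem_nhdsWithin (a := (0 : ℝ)) (s := Set.Ioi 0))).exists
  have hδ0 : 0 < δ := hδ0
  refine ⟨δ, hδ0, fun v hv => ?_⟩
  have hball : ∫⁻ x in Metric.ball 0 δ, P (x, v) ≤ b / 2 := by
    refine (setLIntegral_mono' measurableSet_ball fun x _ => hPS (x, v)).trans ?_
    rw [setLIntegral_const, Measure.addHaar_ball_of_pos _ _ hδ0]
    exact hδ.le
  have hcompl : b / 2 ≤ ∫⁻ x in (Metric.ball 0 δ)ᶜ, P (x, v) := by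
    rw [← lintegral_add_compl _ (measurableSet_ball (x := (0 : E)) (ε := δ))] at hv
    nth_rw 1 [← ENNReal.add_halves b] at hv
    exact ENNReal.le_of_add_le_add_left (ENNReal.div_ne_top hbt two_ne_zero)
      (hv.trans (add_le_add_left hball _))
  calc _ ≤ ENNReal.ofReal (δ ^ q) * ∫⁻ x in (Metric.ball 0 δ)ᶜ, P (x, v) := by gcongr
    _ = ∫⁻ x in (Metric.ball 0 δ)ᶜ, ENNReal.ofReal (δ ^ q) * P (x, v) :=
        (lintegral_const_mul' _ _ ENNReal.ofReal_ne_top).symm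
    _ ≤ ∫⁻ x in (Metric.ball 0 δ)ᶜ, ENNReal.ofReal (‖x‖ ^ q) * P (x, v) := by
        refine setLIntegral_mono' measurableSet_ball.compl fun x hx => ?_
        gcongr
        simpa using hx
    _ ≤ _ := setLIntegral_le_lintegral _ _

theorem exists_bracket_le_moment [Nontrivial E] {P : E × E → ℝ≥0∞} (hPm : Measurable P)
    (hsymm : ∀ x v, P (v - x, v) = P (x, v)) {S : ℝ≥0∞} (hS : S ≠ ⊤) (hPS : ∀ y, P y ≤ S)
    {q γ : ℝ} (hq : 0 ≤ q) (hγ : 0 ≤ γ) {a : ℝ≥0∞} (ha : a ≠ 0)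
    (hM : ∀ v, a * bracket (-γ) v ≤ ∫⁻ x, P (x, v)) :
    ∃ C : ℝ≥0∞, C ≠ 0 ∧ C ≠ ⊤ ∧ ∀ v, C * bracket (q - γ) v ≤
      ∫⁻ x, ENNReal.ofReal (‖x‖ ^ q) * P (x, v) := by
  wlog hat : a ≠ ⊤ generalizing a
  · exact this (a := 1) one_ne_zero (fun v => le_trans (mul_le_mul_left (by simp_all) _) (hM v))
      one_ne_top
  have ho : ∀ {t : ℝ}, 0 < t → ENNReal.ofReal t ≠ 0 := fun ht => (ENNReal.ofReal_pos.2 ht).ne'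
  obtain ⟨δ, hδ, h⟩ := exists_lt_lintegral_norm_rpow_mul hS hPS hq
    (b := a * ENNReal.ofReal (2 ^ (-γ))) (mul_ne_zero ha (ho (by positivity)))
    (ENNReal.mul_ne_top hat ENNReal.ofReal_ne_top)
  set b := a * ENNReal.ofReal (2 ^ (-γ)) with hb
  set C₁ := ENNReal.ofReal (4 ^ (-q)) * a / 2 with hC₁
  set C₂ := ENNReal.ofReal (δ ^ q) * (b / 2) * ENNReal.ofReal (2 ^ (-q)) with hC₂
  refine ⟨min C₁ C₂, ?_, ?_, fun v => ?_⟩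
  · have h1 : C₁ ≠ 0 := (ENNReal.half_pos (mul_ne_zero (ho (by positivity)) ha)).ne'
    have h2 : C₂ ≠ 0 := mul_ne_zero (mul_ne_zero (ho (by positivity))
      (ENNReal.half_pos (mul_ne_zero ha (ho (by positivity)))).ne') (ho (by positivity))
    rcases min_choice C₁ C₂ with e | e <;> rwa [e]
  · exact ne_top_of_le_ne_top (ENNReal.div_ne_top (ENNReal.mul_ne_top ENNReal.ofReal_ne_top hat)
      two_ne_zero) (min_le_left _ _)
  rcases le_total 1 ‖v‖ with hv | hv
  · have h1 := bracket_le_lintegral_norm_rpow_mul_of_one_le hPm hsymm hq hv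
    calc _ ≤ C₁ * bracket (q - γ) v := by gcongr; exact min_le_left _ _
      _ = ENNReal.ofReal (4 ^ (-q)) * bracket q v * (a * bracket (-γ) v) / 2 := by
          rw [sub_eq_add_neg, bracket_add, hC₁]
          simp only [div_eq_mul_inv]
          ring
      _ ≤ (2 * ∫⁻ x, ENNReal.ofReal (‖x‖ ^ q) * P (x, v)) / 2 := by
          refine ENNReal.div_le_div_right (le_trans ?_ h1) _
          gcongr
          exact hM v
      _ = _ := by
          rw [mul_comm, ENNReal.mul_div_cancel_right two_ne_zero ofNat_ne_top]
  · have h1 : b ≤ ∫⁻ x, P (x, v) := by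
      refine le_trans ?_ (hM v)
      rw [hb, bracket]
      exact mul_le_mul_right (ENNReal.ofReal_le_ofReal
        (Real.rpow_le_rpow_of_nonpos (by positivity) (by linarith) (by linarith))) _
    refine le_trans ?_ (h v h1)
    calc _ ≤ C₂ * bracket q v :=
          mul_le_mul' (min_le_right _ _) (bracket_mono (by linarith) v)
      _ = ENNReal.ofReal (δ ^ q) * (b / 2) * (ENNReal.ofReal (2 ^ (-q)) * bracket q v) :=
          mul_assoc _ _ _
      _ ≤ ENNReal.ofReal (δ ^ q) * (b / 2) * 1 := by
          gcongr
          rw [bracket, ← ENNReal.ofReal_mul (by positivity), ← ENNReal.ofReal_one]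
          refine ENNReal.ofReal_le_ofReal ?_
          rw [Real.rpow_neg (by norm_num), ← div_eq_inv_mul, div_le_one (by positivity)]
          exact Real.rpow_le_rpow (by positivity) (by linarith) hq
      _ = _ := mul_one _

end MomentLower

section Main

theorem exists_moment_cosTransform_bounds {E : Type*} [NormedAddCommGroup E]
    [InnerProductSpace ℝ E] [FiniteDimensional ℝ E] [MeasurableSpace E] [BorelSpace E]
    [Nontrivial E] {α q : ℝ} (hα : α ∈ Set.Ioo (0 : ℝ) 2) (hq0 : 0 ≤ q)
    (hq : q < (Module.finrank ℝ E : ℝ) + 2 * α) :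
    ∃ a > 0, ∃ C > 0, ∀ v : E,
      a * (1 + ‖v‖) ^ (q - (Module.finrank ℝ E : ℝ) - α) ≤
        ∫ x, ‖x‖ ^ q * cosTransform (kineticChar α) (x, v) ∧
      ∫ x, ‖x‖ ^ q * cosTransform (kineticChar α) (x, v) ≤
        C * (1 + ‖v‖) ^ (q - (Module.finrank ℝ E : ℝ) - α) := by
  obtain ⟨c, hc, Λ, hΛ, p, hp, hrec, h0, h0', hnn, hP⟩ := exists_poisson_expansion (E := E) hα
  have hfin : IsFiniteMeasure ((stableMeasure E α c).restrict {z : E | 1 ≤ ‖z‖}) :=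
    isFiniteMeasure_stableMeasure_restrict hα hc.le one_pos subset_rfl
  have hrec' : ∀ n, p (n + 1) =
      jumpStep ((stableMeasure E α c).restrict {z : E | 1 ≤ ‖z‖}) (p n) := fun n => funext (hrec n)
  have h_int := integrable_kineticChar (E := E) hα.1
  have hcont := continuous_cosTransform h_int
  set P : E × E → ℝ≥0∞ := fun y => ENNReal.ofReal (cosTransform (kineticChar α) y) with hPdef
  have hPm : Measurable P := hcont.measurable.ennreal_ofReal
  obtain ⟨C, hC, hup⟩ := exists_expansion_moment_le hα.1 hc.le hq0 hq hp hrec' h0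
    ENNReal.ofReal_ne_top (P := P) hP
  obtain ⟨a₀, ha₀, hmass⟩ := exists_bracket_le_mass hα.1 hc hp hrec' h0'
    (ENNReal.ofReal_pos.2 hΛ).ne' (P := P) hP
  obtain ⟨a, ha, hat, hlow⟩ := exists_bracket_le_moment hPm
    (fun x v => by rw [hPdef]; simp only [cosTransform_kineticChar_reflect])
    (S := ENNReal.ofReal (∫ w : E × E, |kineticChar α w|)) ENNReal.ofReal_ne_top
    (fun y => ENNReal.ofReal_le_ofReal ((le_abs_self _).trans (abs_cosTransform_le h_int y)))
    hq0 (by have := hα.1; positivity) ha₀ hmass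
  have hmom : ∀ v : E, ∫ x, ‖x‖ ^ q * cosTransform (kineticChar α) (x, v) =
      (∫⁻ x, ENNReal.ofReal (‖x‖ ^ q) * P (x, v)).toReal := fun v => by
    rw [integral_eq_lintegral_of_nonneg_ae
      (Eventually.of_forall fun x => mul_nonneg (by positivity) (hnn _))
      (Measurable.aestronglyMeasurable (by have := hcont.measurable; fun_prop))]
    congr 1
    exact lintegral_congr fun x => ENNReal.ofReal_mul (by positivity)
  have hbr : ∀ (t : ℝ≥0∞) (v : E), t.toReal * (1 + ‖v‖) ^ (q - (Module.finrank ℝ E : ℝ) - α) =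
      (t * bracket (q - (Module.finrank ℝ E : ℝ) - α) v).toReal := fun t v => by
    rw [ENNReal.toReal_mul, bracket, ENNReal.toReal_ofReal (by positivity)]
  refine ⟨a.toReal, ENNReal.toReal_pos ha hat, C.toReal + 1, by positivity, fun v => ?_⟩
  have hCv : C * bracket (q - (Module.finrank ℝ E : ℝ) - α) v ≠ ⊤ :=
    ENNReal.mul_ne_top hC (bracket_ne_top _ _)
  rw [hmom v]
  constructor
  · rw [hbr]
    refine ENNReal.toReal_mono (ne_top_of_le_ne_top hCv (hup v)) ?_
    rw [sub_sub]
    exact hlow v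
  · calc _ ≤ C.toReal * (1 + ‖v‖) ^ (q - (Module.finrank ℝ E : ℝ) - α) := by
          rw [hbr]; exact ENNReal.toReal_mono hCv (hup v)
      _ ≤ _ := by gcongr; simp

end Main

/-- two-sided bound for the `q`-th conditional spatial moment of the
kinetic heat kernel at time 1. -/
theorem stmt_19 (d : ℕ) (hd : 1 ≤ d) (α : ℝ) (hα : α ∈ Set.Ioo (0 : ℝ) 2)
    (q : ℝ) (hq0 : 0 ≤ q) (hq : q < d + 2 * α) :
    ∃ C ≥ (1 : ℝ), ∀ v : EuclideanSpace ℝ (Fin d),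
      C⁻¹ * (1 + ‖v‖) ^ (q - d - α) ≤
          (∫ x : EuclideanSpace ℝ (Fin d), ‖x‖ ^ q * kinHeat d α 1 x v) ∧
      (∫ x : EuclideanSpace ℝ (Fin d), ‖x‖ ^ q * kinHeat d α 1 x v) ≤
          C * (1 + ‖v‖) ^ (q - d - α) := by
  have : Nonempty (Fin d) := ⟨⟨0, hd⟩⟩
  have hdim : Module.finrank ℝ (EuclideanSpace ℝ (Fin d)) = d := finrank_euclideanSpace_fin
  obtain ⟨a, ha, C, hC, h⟩ := exists_moment_cosTransform_bounds (E := EuclideanSpace ℝ (Fin d))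
    hα hq0 (by rwa [hdim])
  rw [hdim] at h
  set K : ℝ := (2 * π) ^ (-(2 * (d : ℝ))) with hK
  have hK0 : 0 < K := by positivity
  have h_int : ∀ v, ∫ x : EuclideanSpace ℝ (Fin d), ‖x‖ ^ q * kinHeat d α 1 x v =
      K * ∫ x, ‖x‖ ^ q * cosTransform (kineticChar α) (x, v) := fun v => by
    rw [← integral_const_mul]
    exact integral_congr_ae (Eventually.of_forall fun x => mul_left_comm _ K _)
  refine ⟨max 1 (max (K * C) (K * a)⁻¹), le_max_left _ _, fun v => ?_⟩
  rw [h_int]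
  constructor
  · calc _ ≤ K * a * (1 + ‖v‖) ^ (q - d - α) := by
          gcongr
          rw [inv_le_comm₀ (by positivity) (by positivity)]
          exact (le_max_right _ _).trans (le_max_right _ _)
      _ ≤ _ := by rw [mul_assoc]; gcongr; exact (h v).1
  · calc _ ≤ K * C * (1 + ‖v‖) ^ (q - d - α) := by rw [mul_assoc]; gcongr; exact (h v).2
      _ ≤ _ := by
          gcongr
          exact (le_max_left _ _).trans (le_max_right _ _)
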